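/- arXiv:1105.1154 — 14 statements merged into one kernel-verified Lean document; each statement's English description precedes it below -/
import Mathlib

section
/- Let n ≥ 1 and let w₁, w₂ ∈ ℝⁿ × ℝ be negative vectors for the Minkowski form I with I(w₁,w₂) ≥ 0. Then the following are equivalent: (a) there exists q = (v,u) ∈ ℝⁿ × ℝ with u > 0, I(q,q) ≥ 0, and I(w₁,q) = I(w₂,q) = 0; (b) for all real a, b ≥ 0 one has I(a·w₁ + b·w₂, a·w₁ + b·w₂) ≤ 0. -/
open scoped RealInnerProductSpace

/-- The Minkowski form `I((v,u),(v',u')) = -⟨v,v'⟩ + u·u'` on `ℝⁿ × ℝ`. -/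
noncomputable def minkI {n : ℕ} (w w' : EuclideanSpace ℝ (Fin n) × ℝ) : ℝ :=
  -⟪w.1, w'.1⟫ + w.2 * w'.2

section MinkowskiForm

variable {n : ℕ} (w w' q : EuclideanSpace ℝ (Fin n) × ℝ) (c : ℝ)

lemma minkI_comm : minkI w w' = minkI w' w := by
  simp only [minkI, real_inner_comm, mul_comm]

lemma minkI_add_left : minkI (w + w') q = minkI w q + minkI w' q := by
  simp only [minkI, Prod.fst_add, Prod.snd_add, inner_add_left]
  ring

lemma minkI_smul_left : minkI (c • w) q = c * minkI w q := by
  simp only [minkI, Prod.smul_fst, Prod.smul_snd, real_inner_smul_left, smul_eq_mul]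
  ring

lemma minkI_add_right : minkI q (w + w') = minkI q w + minkI q w' := by
  rw [minkI_comm, minkI_add_left, minkI_comm w, minkI_comm w']

lemma minkI_smul_right : minkI q (c • w) = c * minkI q w := by
  rw [minkI_comm, minkI_smul_left, minkI_comm w]

lemma minkI_zero_one_right : minkI w (0, 1) = w.2 := by simp [minkI]

lemma minkI_zero_one_left : minkI (0, 1) w = w.2 := by simp [minkI]

lemma minkI_self : minkI w w = w.2 ^ 2 - ‖w.1‖ ^ 2 := by
  rw [minkI, real_inner_self_eq_norm_sq]
  ring

variable {w w' q}

/-- A vector orthogonal to a future-directed causal vector is not timelike. -/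
lemma minkI_self_nonpos_of_orthogonal (hq : 0 < q.2) (hqq : 0 ≤ minkI q q)
    (h : minkI w q = 0) : minkI w w ≤ 0 := by
  rw [minkI_self] at hqq ⊢
  have hnorm : ‖q.1‖ ≤ q.2 := abs_le_of_sq_le_sq' (by linarith) hq.le |>.2
  have hinner : ⟪w.1, q.1⟫ = w.2 * q.2 := by
    rw [minkI] at h
    linarith
  have hle : |w.2| * q.2 ≤ ‖w.1‖ * q.2 := by
    calc |w.2| * q.2 = |⟪w.1, q.1⟫| := by rw [hinner, abs_mul, abs_of_pos hq]
      _ ≤ ‖w.1‖ * ‖q.1‖ := abs_real_inner_le_norm _ _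
      _ ≤ ‖w.1‖ * q.2 := by gcongr
  have := sq_le_sq' (by linarith [abs_nonneg w.2, norm_nonneg w.1])
    (le_of_mul_le_mul_right hle hq)
  rw [sq_abs] at this
  linarith

/-- A null vector whose time coordinate vanishes is zero. -/
lemma eq_zero_of_minkI_self_eq_zero (h : minkI w w = 0) (h2 : w.2 = 0) : w = 0 := by
  rw [minkI_self, h2] at h
  have h1 : ‖w.1‖ = 0 := by
    apply pow_eq_zero_iff two_ne_zero |>.1
    linarith
  exact Prod.ext (norm_eq_zero.1 h1) h2

/-- The reversed Cauchy-Schwarz inequality follows from nonpositivity on the cone spanned by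
two negative vectors with nonnegative product. -/
lemma minkI_sq_le_of_nonpos_on_cone (hw' : minkI w' w' < 0) (hww' : 0 ≤ minkI w w')
    (h : ∀ a b : ℝ, 0 ≤ a → 0 ≤ b → minkI (a • w + b • w') (a • w + b • w') ≤ 0) :
    minkI w w' ^ 2 ≤ minkI w w * minkI w' w' := by
  have := h (-minkI w' w') (minkI w w') (by linarith) hww'
  simp only [minkI_add_left, minkI_add_right, minkI_smul_left, minkI_smul_right,
    minkI_comm w' w] at this
  nlinarith

lemma exists_causal_orthogonal_of_sq_lt (hw' : minkI w' w' < 0)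
    (h : minkI w w' ^ 2 < minkI w w * minkI w' w') :
    ∃ q : EuclideanSpace ℝ (Fin n) × ℝ, 0 < q.2 ∧ 0 ≤ minkI q q ∧
      minkI w q = 0 ∧ minkI w' q = 0 := by
  set A := minkI w w with hA
  set B := minkI w w' with hB
  set C := minkI w' w' with hC
  have hD : 0 < A * C - B ^ 2 := by linarith
  have hD0 := hD.ne'
  set x := (C * w.2 - B * w'.2) / (A * C - B ^ 2) with hx
  set y := (A * w'.2 - B * w.2) / (A * C - B ^ 2) with hy
  have horth : A * x + B * y = w.2 := by
    rw [hx, hy, ← mul_div_assoc, ← mul_div_assoc, ← add_div, div_eq_iff hD0]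
    ring
  have horth' : B * x + C * y = w'.2 := by
    rw [hx, hy, ← mul_div_assoc, ← mul_div_assoc, ← add_div, div_eq_iff hD0]
    ring
  have hproj : x * w.2 + y * w'.2 ≤ 0 := by
    have : x * w.2 + y * w'.2 =
        (C * w.2 ^ 2 - 2 * B * w.2 * w'.2 + A * w'.2 ^ 2) / (A * C - B ^ 2) := by
      rw [hx, hy]
      ring
    rw [this]
    refine div_nonpos_of_nonpos_of_nonneg ?_ hD.le
    refine nonpos_of_mul_nonneg_right ?_ hw'
    nlinarith [sq_nonneg (C * w.2 - B * w'.2), mul_nonneg hD.le (sq_nonneg w'.2)]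
  set q : EuclideanSpace ℝ (Fin n) × ℝ := (0, 1) + ((-x) • w + (-y) • w') with hq
  have hwq : minkI w q = 0 := by
    rw [hq, minkI_add_right, minkI_add_right, minkI_smul_right, minkI_smul_right,
      minkI_zero_one_right]
    linarith
  have hwq' : minkI w' q = 0 := by
    rw [hq, minkI_add_right, minkI_add_right, minkI_smul_right, minkI_smul_right,
      minkI_zero_one_right, minkI_comm w' w]
    linarith
  have hq2 : 0 < q.2 := by
    simp only [hq, Prod.snd_add, Prod.smul_snd, smul_eq_mul]
    linarith
  have hqq : minkI q q = q.2 := by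
    nth_rewrite 1 [hq]
    rw [minkI_add_left, minkI_add_left, minkI_smul_left, minkI_smul_left, hwq, hwq',
      minkI_zero_one_left]
    ring
  exact ⟨q, hq2, hqq ▸ hq2.le, hwq, hwq'⟩

lemma exists_causal_orthogonal_of_sq_eq (hw : minkI w w < 0) (hw' : minkI w' w' < 0)
    (h : minkI w w' ^ 2 = minkI w w * minkI w' w') :
    ∃ q : EuclideanSpace ℝ (Fin n) × ℝ, 0 < q.2 ∧ 0 ≤ minkI q q ∧
      minkI w q = 0 ∧ minkI w' q = 0 := by
  set r := (-minkI w' w') • w + minkI w w' • w' with hr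
  have hwr : minkI w r = 0 := by
    rw [hr, minkI_add_right, minkI_smul_right, minkI_smul_right]
    linarith
  have hwr' : minkI w' r = 0 := by
    rw [hr, minkI_add_right, minkI_smul_right, minkI_smul_right, minkI_comm w' w]
    ring
  have hrr : minkI r r = 0 := by
    nth_rewrite 1 [hr]
    rw [minkI_add_left, minkI_smul_left, minkI_smul_left, hwr, hwr']
    ring
  by_cases hr2 : r.2 = 0
  · have hr0 : r = 0 := eq_zero_of_minkI_self_eq_zero hrr hr2
    set q : EuclideanSpace ℝ (Fin n) × ℝ := (0, 1) + (-(w.2 / minkI w w)) • w with hq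
    have hwq : minkI w q = 0 := by
      rw [hq, minkI_add_right, minkI_smul_right, minkI_zero_one_right]
      rw [neg_mul, div_mul_cancel₀ _ hw.ne, add_neg_cancel]
    have hwq' : minkI w' q = 0 := by
      have hrq : minkI r q = 0 := by simp [hr0, minkI]
      rw [hr, minkI_add_left, minkI_smul_left, minkI_smul_left, hwq, mul_zero, zero_add] at hrq
      refine (mul_eq_zero.1 hrq).resolve_left fun h0 ↦ ?_
      rw [h0] at h
      nlinarith [mul_pos_of_neg_of_neg hw hw']
    have hq2 : 0 < q.2 := by
      have : w.2 / minkI w w * w.2 ≤ 0 := by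
        rw [div_mul_eq_mul_div]
        exact div_nonpos_of_nonneg_of_nonpos (mul_self_nonneg _) hw.le
      simp only [hq, Prod.snd_add, Prod.smul_snd, smul_eq_mul]
      linarith
    have hqq : minkI q q = q.2 := by
      nth_rewrite 1 [hq]
      rw [minkI_add_left, minkI_smul_left, hwq, minkI_zero_one_left]
      ring
    exact ⟨q, hq2, hqq ▸ hq2.le, hwq, hwq'⟩
  · refine ⟨r.2 • r, ?_, ?_, ?_, ?_⟩
    · simpa using mul_self_pos.2 hr2
    all_goals simp [minkI_smul_left, minkI_smul_right, hrr, hwr, hwr']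

end MinkowskiForm

theorem stmt1 {n : ℕ} (hn : 1 ≤ n) (w₁ w₂ : EuclideanSpace ℝ (Fin n) × ℝ)
    (h₁ : minkI w₁ w₁ < 0) (h₂ : minkI w₂ w₂ < 0) (h₁₂ : 0 ≤ minkI w₁ w₂) :
    (∃ q : EuclideanSpace ℝ (Fin n) × ℝ, 0 < q.2 ∧ 0 ≤ minkI q q ∧
        minkI w₁ q = 0 ∧ minkI w₂ q = 0) ↔
      ∀ a b : ℝ, 0 ≤ a → 0 ≤ b →
        minkI (a • w₁ + b • w₂) (a • w₁ + b • w₂) ≤ 0 := by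
  constructor
  · rintro ⟨q, hq, hqq, hq₁, hq₂⟩ a b - -
    refine minkI_self_nonpos_of_orthogonal hq hqq ?_
    rw [minkI_add_left, minkI_smul_left, minkI_smul_left, hq₁, hq₂]
    ring
  · intro h
    rcases (minkI_sq_le_of_nonpos_on_cone h₂ h₁₂ h).lt_or_eq with hlt | heq
    · exact exists_causal_orthogonal_of_sq_lt h₂ hlt
    · exact exists_causal_orthogonal_of_sq_eq h₁ h₂ heq
end

section
/- Let n ≥ 2 and let z₁, …, z_m be m distinct points of the Euclidean space ℝ^{n−1}, and let d₁, …, d_m > 0 be real numbers such that √(d_i² + d_j²) ≤ ‖z_i − z_j‖ ≤ d_i + d_j for all i ≠ j. Then there exist vectors h, w₁, …, w_m ∈ ℝⁿ × ℝ such that for all distinct indices i, j: I(h,h) > 0 > I(w_i,w_i), I(h,w_i) > 0, I(w_i,w_j) ≥ 0, and I(a·w_i + b·w_j, a·w_i + b·w_j) ≤ 0 for all real a, b ≥ 0. -/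
open scoped RealInnerProductSpace

lemma minkI_combination_self {n : ℕ} (w w' : EuclideanSpace ℝ (Fin n) × ℝ) (a b : ℝ) :
    minkI (a • w + b • w') (a • w + b • w') =
      a ^ 2 * minkI w w + 2 * a * b * minkI w w' + b ^ 2 * minkI w' w' := by
  simp only [minkI, Prod.fst_add, Prod.snd_add, Prod.smul_fst, Prod.smul_snd, smul_eq_mul,
    inner_add_left, inner_add_right, real_inner_smul_left, real_inner_smul_right,
    real_inner_comm w.1 w'.1]
  ring

lemma minkI_smul_smul {n : ℕ} (w w' : EuclideanSpace ℝ (Fin n) × ℝ) (a b : ℝ) :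
    minkI (a • w) (b • w') = a * b * minkI w w' := by
  simp only [minkI, Prod.smul_fst, Prod.smul_snd, smul_eq_mul,
    real_inner_smul_left, real_inner_smul_right]
  ring

/-- The vector with light-cone coordinates `p`, `q` and Euclidean component `z`. -/
noncomputable def lightConeVec {k : ℕ} (z : EuclideanSpace ℝ (Fin k)) (p q : ℝ) :
    EuclideanSpace ℝ (Fin (k + 1)) × ℝ :=
  (WithLp.toLp 2 (Fin.cons ((p - q) / 2) z.ofLp), (p + q) / 2)

lemma minkI_lightConeVec {k : ℕ} (z z' : EuclideanSpace ℝ (Fin k)) (p q p' q' : ℝ) :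
    minkI (lightConeVec z p q) (lightConeVec z' p' q') =
      (p * q' + q * p') / 2 - ⟪z, z'⟫ := by
  simp only [minkI, lightConeVec, PiLp.inner_apply, Fin.sum_univ_succ, Fin.cons_zero,
    Fin.cons_succ, RCLike.inner_apply, conj_trivial]
  ring

/-- The normalized vector representing the sphere with centre `z` and radius `d`. -/
noncomputable def sphereVec {k : ℕ} (z : EuclideanSpace ℝ (Fin k)) (d : ℝ) :
    EuclideanSpace ℝ (Fin (k + 1)) × ℝ :=
  d⁻¹ • lightConeVec z (‖z‖ ^ 2 - d ^ 2) 1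

lemma minkI_sphereVec {k : ℕ} (z z' : EuclideanSpace ℝ (Fin k)) (d d' : ℝ) :
    minkI (sphereVec z d) (sphereVec z' d') =
      (‖z - z'‖ ^ 2 - d ^ 2 - d' ^ 2) / (2 * (d * d')) := by
  rw [sphereVec, sphereVec, minkI_smul_smul, minkI_lightConeVec, norm_sub_sq_real,
    div_eq_mul_inv _ (2 * (d * d')), mul_inv, mul_inv]
  ring

lemma minkI_sphereVec_self {k : ℕ} (z : EuclideanSpace ℝ (Fin k)) {d : ℝ} (hd : d ≠ 0) :
    minkI (sphereVec z d) (sphereVec z d) = -1 := by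
  rw [minkI_sphereVec, sub_self, norm_zero]
  field_simp
  ring

lemma minkI_lightConeVec_sphereVec {k : ℕ} (y z : EuclideanSpace ℝ (Fin k)) (p q d : ℝ) :
    minkI (lightConeVec y p q) (sphereVec z d) =
      d⁻¹ * ((p + q * (‖z‖ ^ 2 - d ^ 2)) / 2 - ⟪y, z⟫) := by
  rw [sphereVec, ← one_smul ℝ (lightConeVec y p q), minkI_smul_smul, minkI_lightConeVec,
    one_mul, mul_one]

theorem stmt2 {n m : ℕ} (hn : 2 ≤ n) (z : Fin m → EuclideanSpace ℝ (Fin (n - 1)))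
    (hzinj : Function.Injective z) (d : Fin m → ℝ) (hd : ∀ i, 0 < d i)
    (hzd : ∀ i j, i ≠ j →
      Real.sqrt (d i ^ 2 + d j ^ 2) ≤ ‖z i - z j‖ ∧ ‖z i - z j‖ ≤ d i + d j) :
    ∃ (h : EuclideanSpace ℝ (Fin n) × ℝ) (w : Fin m → EuclideanSpace ℝ (Fin n) × ℝ),
      0 < minkI h h ∧ (∀ i, minkI (w i) (w i) < 0) ∧ (∀ i, 0 < minkI h (w i)) ∧
      ∀ i j, i ≠ j → 0 ≤ minkI (w i) (w j) ∧
        ∀ a b : ℝ, 0 ≤ a → 0 ≤ b →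
          minkI (a • w i + b • w j) (a • w i + b • w j) ≤ 0 := by
  obtain ⟨k, rfl⟩ : ∃ k, n = k + 1 := ⟨n - 1, by omega⟩
  change Fin m → EuclideanSpace ℝ (Fin k) at z
  have hS : 0 ≤ ∑ i, d i ^ 2 := Finset.sum_nonneg fun i _ => sq_nonneg _
  refine ⟨lightConeVec 0 (1 + ∑ i, d i ^ 2) 1, fun i => sphereVec (z i) (d i), ?_,
    fun i => ?_, fun i => ?_, fun i j hij => ?_⟩
  · rw [minkI_lightConeVec, inner_zero_left]
    linarith
  · rw [minkI_sphereVec_self _ (hd i).ne']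
    norm_num
  · have hi : d i ^ 2 ≤ ∑ i, d i ^ 2 :=
      Finset.single_le_sum (fun i _ => sq_nonneg (d i)) (Finset.mem_univ i)
    rw [minkI_lightConeVec_sphereVec, inner_zero_left]
    refine mul_pos (inv_pos.mpr (hd i)) ?_
    linarith [sq_nonneg ‖z i‖]
  · obtain ⟨hlow, hupp⟩ := hzd i j hij
    have hdd : 0 < 2 * (d i * d j) := mul_pos two_pos (mul_pos (hd i) (hd j))
    have hlow' : d i ^ 2 + d j ^ 2 ≤ ‖z i - z j‖ ^ 2 :=
      (Real.sqrt_le_left (norm_nonneg _)).mp hlow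
    have hupp' : ‖z i - z j‖ ^ 2 ≤ (d i + d j) ^ 2 :=
      pow_le_pow_left₀ (norm_nonneg _) hupp 2
    have hle : minkI (sphereVec (z i) (d i)) (sphereVec (z j) (d j)) ≤ 1 := by
      rw [minkI_sphereVec, div_le_one hdd]
      linarith
    refine ⟨?_, fun a b ha hb => ?_⟩
    · rw [minkI_sphereVec]
      exact div_nonneg (by linarith) hdd.le
    · rw [minkI_combination_self, minkI_sphereVec_self _ (hd i).ne',
        minkI_sphereVec_self _ (hd j).ne']
      nlinarith [sq_nonneg (a - b), mul_le_mul_of_nonneg_left hle (mul_nonneg ha hb)]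
end

section
/- Let E be a real Euclidean (finite-dimensional inner product) space, let z₁, z₂, z₃ ∈ E, and let d₁, d₂, d₃ > 0 be real numbers such that √(d_i² + d_j²) ≤ ‖z_i − z_j‖ ≤ d_i + d_j for all i ≠ j. Then z₁, z₂, z₃ are not collinear (in particular they are pairwise distinct and affinely independent, so dim E ≥ 2). -/
theorem not_wbtw_of_sqrt_le_dist {E : Type*} [NormedAddCommGroup E] [NormedSpace ℝ E]
    {x y z : E} {a b c : ℝ} (hb : 0 < b)
    (hxy : Real.sqrt (a ^ 2 + b ^ 2) ≤ dist x y)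
    (hyz : Real.sqrt (b ^ 2 + c ^ 2) ≤ dist y z) (hxz : dist x z ≤ a + c) :
    ¬ Wbtw ℝ x y z := by
  intro h
  have ha : a < Real.sqrt (a ^ 2 + b ^ 2) := Real.lt_sqrt_of_sq_lt (by nlinarith)
  have hc : c < Real.sqrt (b ^ 2 + c ^ 2) := Real.lt_sqrt_of_sq_lt (by nlinarith)
  linarith [h.dist_add_dist]

theorem stmt3 {E : Type*} [NormedAddCommGroup E] [InnerProductSpace ℝ E]
    [FiniteDimensional ℝ E] (z₁ z₂ z₃ : E) (d₁ d₂ d₃ : ℝ)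
    (hd₁ : 0 < d₁) (hd₂ : 0 < d₂) (hd₃ : 0 < d₃)
    (h₁₂ : Real.sqrt (d₁ ^ 2 + d₂ ^ 2) ≤ ‖z₁ - z₂‖ ∧ ‖z₁ - z₂‖ ≤ d₁ + d₂)
    (h₁₃ : Real.sqrt (d₁ ^ 2 + d₃ ^ 2) ≤ ‖z₁ - z₃‖ ∧ ‖z₁ - z₃‖ ≤ d₁ + d₃)
    (h₂₃ : Real.sqrt (d₂ ^ 2 + d₃ ^ 2) ≤ ‖z₂ - z₃‖ ∧ ‖z₂ - z₃‖ ≤ d₂ + d₃) :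
    ¬ Collinear ℝ ({z₁, z₂, z₃} : Set E) := by
  simp only [← dist_eq_norm] at h₁₂ h₁₃ h₂₃
  intro h
  rcases h.wbtw_or_wbtw_or_wbtw with h | h | h
  · exact not_wbtw_of_sqrt_le_dist hd₂ h₁₂.1 h₂₃.1 h₁₃.2 h
  · refine not_wbtw_of_sqrt_le_dist (c := d₁) hd₃ h₂₃.1 ?_ ?_ h
    · rw [add_comm, dist_comm]; exact h₁₃.1
    · rw [add_comm, dist_comm]; exact h₁₂.2
  · refine not_wbtw_of_sqrt_le_dist (a := d₃) hd₁ ?_ h₁₂.1 ?_ h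
    · rw [add_comm, dist_comm]; exact h₁₃.1
    · rw [add_comm, dist_comm]; exact h₂₃.2
end

section
/- Let E be a real Euclidean (finite-dimensional inner product) space, let z₁, z₂, z₃ ∈ E, and let 0 < d₁ ≤ d₂ ≤ d₃ be real numbers such that √(d_i² + d_j²) ≤ ‖z_i − z_j‖ ≤ d_i + d_j for all i ≠ j. Then the angle θ₁ = ∠(z₂, z₁, z₃) of the triangle (z₁, z₂, z₃) at the vertex z₁ satisfies θ₁ ≥ arccos(3/4); equivalently, cos θ₁ ≤ 3/4. -/
/-- A monic quadratic without constant term is bounded on an interval by its endpoint values. -/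
theorem sq_sub_mul_le_of_endpoints {s A x k M : ℝ} (hs : s ≤ x) (hA : x ≤ A)
    (h₁ : s ^ 2 - k * s ≤ M) (h₂ : A ^ 2 - k * A ≤ M) : x ^ 2 - k * x ≤ M := by
  rcases le_total 0 (s + A - k) with h | h
  · nlinarith [mul_nonneg (sub_nonneg.2 hs) (sub_nonneg.2 hA), mul_nonneg h (sub_nonneg.2 hA)]
  · nlinarith [mul_nonneg (sub_nonneg.2 hs) (sub_nonneg.2 hA),
      mul_nonneg (neg_nonneg.2 h) (sub_nonneg.2 hs)]

theorem four_thirds_mul_le_sqrt_add_sq {x y : ℝ} (hx : 0 ≤ x) (hxy : x ≤ y) :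
    4 / 3 * x ≤ √(x ^ 2 + y ^ 2) := by
  apply Real.le_sqrt_of_sq_le
  nlinarith

/-- Side lengths `a`, `b` between `√(x² + y²)` and `x + y`, resp. `√(x² + w²)` and `x + w`,
satisfy the bound that the law of cosines turns into `cos θ ≤ 3 / 4`. -/
theorem sq_add_sq_sub_mul_le {x y w a b : ℝ} (hx : 0 < x) (hxy : x ≤ y) (hyw : y ≤ w)
    (ha : √(x ^ 2 + y ^ 2) ≤ a) (ha' : a ≤ x + y)
    (hb : √(x ^ 2 + w ^ 2) ≤ b) (hb' : b ≤ x + w) :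
    a ^ 2 + b ^ 2 - 3 / 2 * (a * b) ≤ y ^ 2 + w ^ 2 := by
  have hs := four_thirds_mul_le_sqrt_add_sq hx.le hxy
  have ht := four_thirds_mul_le_sqrt_add_sq hx.le (hxy.trans hyw)
  have hs2 : √(x ^ 2 + y ^ 2) ^ 2 = x ^ 2 + y ^ 2 := Real.sq_sqrt (by positivity)
  have ht2 : √(x ^ 2 + w ^ 2) ^ 2 = x ^ 2 + w ^ 2 := Real.sq_sqrt (by positivity)
  set s := √(x ^ 2 + y ^ 2)
  set t := √(x ^ 2 + w ^ 2)
  have key (c : ℝ) (h₁ : t ^ 2 - 3 / 2 * c * t ≤ y ^ 2 + w ^ 2 - c ^ 2)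
      (h₂ : (x + w) ^ 2 - 3 / 2 * c * (x + w) ≤ y ^ 2 + w ^ 2 - c ^ 2) :
      c ^ 2 - 3 / 2 * b * c ≤ y ^ 2 + w ^ 2 - b ^ 2 := by
    linarith [sq_sub_mul_le_of_endpoints hb hb' h₁ h₂]
  have h := sq_sub_mul_le_of_endpoints ha ha' (key s ?_ ?_) (key (x + y) ?_ ?_)
  · linarith
  · nlinarith [mul_le_mul hs ht (by positivity) (by positivity)]
  · nlinarith [mul_le_mul_of_nonneg_right hs (by linarith : 0 ≤ x + w)]
  · nlinarith [mul_le_mul_of_nonneg_right ht (by linarith : 0 ≤ x + y)]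
  · nlinarith [mul_le_mul hxy (hxy.trans hyw) hx.le (by linarith),
      mul_le_mul_of_nonneg_right hxy (by linarith : 0 ≤ w),
      mul_le_mul_of_nonneg_right (hxy.trans hyw) (by linarith : 0 ≤ y)]

theorem stmt4 {E : Type*} [NormedAddCommGroup E] [InnerProductSpace ℝ E]
    [FiniteDimensional ℝ E] (z₁ z₂ z₃ : E) (d₁ d₂ d₃ : ℝ)
    (hd₁ : 0 < d₁) (hd₁₂ : d₁ ≤ d₂) (hd₂₃ : d₂ ≤ d₃)
    (h₁₂ : Real.sqrt (d₁ ^ 2 + d₂ ^ 2) ≤ ‖z₁ - z₂‖ ∧ ‖z₁ - z₂‖ ≤ d₁ + d₂)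
    (h₁₃ : Real.sqrt (d₁ ^ 2 + d₃ ^ 2) ≤ ‖z₁ - z₃‖ ∧ ‖z₁ - z₃‖ ≤ d₁ + d₃)
    (h₂₃ : Real.sqrt (d₂ ^ 2 + d₃ ^ 2) ≤ ‖z₂ - z₃‖ ∧ ‖z₂ - z₃‖ ≤ d₂ + d₃) :
    Real.arccos (3 / 4) ≤ EuclideanGeometry.angle z₂ z₁ z₃ := by
  have hab := sq_add_sq_sub_mul_le hd₁ hd₁₂ hd₂₃ h₁₂.1 h₁₂.2 h₁₃.1 h₁₃.2
  have hc : d₂ ^ 2 + d₃ ^ 2 ≤ ‖z₂ - z₃‖ ^ 2 := (Real.sqrt_le_left (norm_nonneg _)).1 h₂₃.1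
  have ha : 0 < ‖z₁ - z₂‖ := lt_of_lt_of_le (Real.sqrt_pos.2 (by positivity)) h₁₂.1
  have hb : 0 < ‖z₁ - z₃‖ := lt_of_lt_of_le (Real.sqrt_pos.2 (by positivity)) h₁₃.1
  have hin := norm_sub_sq_real (z₂ - z₁) (z₃ - z₁)
  rw [sub_sub_sub_cancel_right, norm_sub_rev z₂ z₁, norm_sub_rev z₃ z₁] at hin
  unfold EuclideanGeometry.angle InnerProductGeometry.angle
  apply Real.arccos_le_arccos
  rw [vsub_eq_sub, vsub_eq_sub, norm_sub_rev z₂ z₁, norm_sub_rev z₃ z₁,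
    div_le_iff₀ (mul_pos ha hb)]
  linarith
end

section
/- Let E be a real Euclidean (finite-dimensional inner product) space, let z₁, …, z_m ∈ E with m ≥ 2, and let d₁, …, d_m > 0 satisfy √(d_i² + d_j²) ≤ ‖z_i − z_j‖ ≤ d_i + d_j for all i ≠ j, with d₁ ≤ d_i for all i. Then the points z_i are pairwise distinct, and the unit vectors ξ_i = (z_i − z₁)/‖z_i − z₁‖ for 2 ≤ i ≤ m are pairwise distinct and satisfy ⟨ξ_i, ξ_j⟩ ≤ 3/4 for all 2 ≤ i < j ≤ m; that is, {ξ₂, …, ξ_m} is a spherical code of angle at least arccos(3/4). -/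
open scoped RealInnerProductSpace

theorem sq_sub_mul_le_of_endpoints_s6 {p q a c k : ℝ} (hpa : p ≤ a) (haq : a ≤ q)
    (hp : p ^ 2 - c * p ≤ k) (hq : q ^ 2 - c * q ≤ k) : a ^ 2 - c * a ≤ k := by
  rcases le_total c (q + a) with h | h
  · nlinarith [mul_nonneg (sub_nonneg.2 haq) (sub_nonneg.2 h)]
  · have h' : 0 ≤ c - a - p := by linarith
    nlinarith [mul_nonneg (sub_nonneg.2 hpa) h']

theorem seven_tenths_mul_add_le {r s a : ℝ} (ha : 0 ≤ a) (h : r ^ 2 + s ^ 2 ≤ a ^ 2) :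
    7 / 10 * (r + s) ≤ a :=
  le_of_sq_le_sq (by nlinarith [sq_nonneg (r - s), sq_nonneg (r + s)]) ha

theorem sq_add_sq_sub_le_three_halves_mul {r s t a b : ℝ} (hr : 0 < r) (hs : r ≤ s) (ht : r ≤ t)
    (ha : 0 ≤ a) (hb : 0 ≤ b) (has : r ^ 2 + s ^ 2 ≤ a ^ 2) (has' : a ≤ r + s)
    (hbt : r ^ 2 + t ^ 2 ≤ b ^ 2) (hbt' : b ≤ r + t) :
    a ^ 2 + b ^ 2 - s ^ 2 - t ^ 2 ≤ 3 / 2 * (a * b) := by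
  have hpa := seven_tenths_mul_add_le ha has
  have hpb := seven_tenths_mul_add_le hb hbt
  obtain ⟨u, rfl⟩ : ∃ u, s = r + u := ⟨s - r, by ring⟩
  obtain ⟨v, rfl⟩ : ∃ v, t = r + v := ⟨t - r, by ring⟩
  have hu : 0 ≤ u := by linarith
  have hv : 0 ≤ v := by linarith
  have hru := mul_nonneg hr.le hu
  have hrv := mul_nonneg hr.le hv
  have huv := mul_nonneg hu hv
  have key : a ^ 2 - (3 / 2 * b) * a ≤ (r + u) ^ 2 + (r + v) ^ 2 - b ^ 2 := by
    refine sq_sub_mul_le_of_endpoints_s6 hpa has' ?_ ?_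
    · have := sq_sub_mul_le_of_endpoints_s6 (c := 3 / 2 * (7 / 10 * (r + (r + u))))
        (k := (r + u) ^ 2 + (r + v) ^ 2 - (7 / 10 * (r + (r + u))) ^ 2) hpb hbt'
        (by nlinarith) (by nlinarith)
      linarith
    · have := sq_sub_mul_le_of_endpoints_s6 (c := 3 / 2 * (r + (r + u)))
        (k := (r + u) ^ 2 + (r + v) ^ 2 - (r + (r + u)) ^ 2) hpb hbt'
        (by nlinarith) (by nlinarith)
      linarith
  linarith

theorem stmt6 {E : Type*} [NormedAddCommGroup E] [InnerProductSpace ℝ E]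
    [FiniteDimensional ℝ E] {m : ℕ} (hm : 2 ≤ m) (z : Fin m → E) (d : Fin m → ℝ)
    (i₁ : Fin m) (hd : ∀ i, 0 < d i) (hd1 : ∀ i, d i₁ ≤ d i)
    (hzd : ∀ i j, i ≠ j →
      Real.sqrt (d i ^ 2 + d j ^ 2) ≤ ‖z i - z j‖ ∧ ‖z i - z j‖ ≤ d i + d j) :
    (∀ i j, i ≠ j → z i ≠ z j) ∧
    (∀ i : Fin m, i ≠ i₁ → ‖‖z i - z i₁‖⁻¹ • (z i - z i₁)‖ = 1) ∧
    ∀ i j : Fin m, i ≠ i₁ → j ≠ i₁ → i ≠ j →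
      ‖z i - z i₁‖⁻¹ • (z i - z i₁) ≠ ‖z j - z i₁‖⁻¹ • (z j - z i₁) ∧
      ⟪‖z i - z i₁‖⁻¹ • (z i - z i₁), ‖z j - z i₁‖⁻¹ • (z j - z i₁)⟫ ≤ 3 / 4 := by
  have hsq : ∀ i j, i ≠ j → d i ^ 2 + d j ^ 2 ≤ ‖z i - z j‖ ^ 2 := fun i j hij =>
    (Real.sqrt_le_left (norm_nonneg _)).1 (hzd i j hij).1
  have hpos : ∀ i j, i ≠ j → 0 < ‖z i - z j‖ := fun i j hij =>
    (Real.sqrt_pos.2 (by have := hd i; positivity)).trans_le (hzd i j hij).1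
  have hunit : ∀ i, i ≠ i₁ → ‖‖z i - z i₁‖⁻¹ • (z i - z i₁)‖ = 1 := fun i hi => by
    rw [norm_smul, norm_inv, norm_norm, inv_mul_cancel₀ (hpos i i₁ hi).ne']
  refine ⟨fun i j hij => sub_ne_zero.1 (norm_pos_iff.1 (hpos i j hij)), hunit, ?_⟩
  intro i j hi hj hij
  have hinner : ⟪‖z i - z i₁‖⁻¹ • (z i - z i₁), ‖z j - z i₁‖⁻¹ • (z j - z i₁)⟫ ≤ 3 / 4 := by
    have hi0 := hpos i i₁ hi
    have hj0 := hpos j i₁ hj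
    have hcos := norm_sub_sq_real (z i - z i₁) (z j - z i₁)
    rw [sub_sub_sub_cancel_right] at hcos
    have hbound := sq_add_sq_sub_le_three_halves_mul (hd i₁) (hd1 i) (hd1 j) hi0.le hj0.le
      (by linarith [hsq i i₁ hi]) (by linarith [(hzd i i₁ hi).2])
      (by linarith [hsq j i₁ hj]) (by linarith [(hzd j i₁ hj).2])
    rw [real_inner_smul_left, real_inner_smul_right, ← mul_assoc, ← mul_inv,
      inv_mul_le_iff₀ (mul_pos hi0 hj0)]
    linarith [hsq i j hij]
  refine ⟨fun heq => ?_, hinner⟩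
  rw [heq, real_inner_self_eq_norm_sq, hunit j hj] at hinner
  norm_num at hinner
end

section
/- Let n ≥ 2, let z₁, …, z_m ∈ ℝ^{n−1} and d₁, …, d_m > 0 satisfy √(d_i² + d_j²) ≤ ‖z_i − z_j‖ ≤ d_i + d_j for all i ≠ j. Suppose N is a natural number such that every finite set of unit vectors in ℝ^{n−1} with pairwise inner products at most 3/4 has cardinality at most N. Then m ≤ N + 1. (In the notation of the paper, m ≤ K_{n−1}(φ₀) + 1 with φ₀ = arccos(3/4).) -/
open scoped RealInnerProductSpace

/-- A monic quadratic that is nonpositive at `p` and `q` is nonpositive between them. -/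
theorem sq_add_mul_add_nonpos_of_mem_Icc {a p q β γ : ℝ} (hp : p ≤ a) (hq : a ≤ q)
    (h₁ : p ^ 2 + β * p + γ ≤ 0) (h₂ : q ^ 2 + β * q + γ ≤ 0) : a ^ 2 + β * a + γ ≤ 0 := by
  rcases eq_or_lt_of_le hp with rfl | hpa
  · exact h₁
  · have hpq : 0 < q - p := by linarith
    by_contra! h
    nlinarith [mul_nonneg (sub_nonneg.2 hp) (sub_nonneg.2 hq), mul_pos hpq h,
      mul_nonneg (sub_nonneg.2 hp) (neg_nonneg.2 h₂),
      mul_nonneg (sub_nonneg.2 hq) (neg_nonneg.2 h₁),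
      mul_nonneg hpq.le (mul_nonneg (sub_nonneg.2 hp) (sub_nonneg.2 hq))]

theorem sq_add_sq_sub_le_of_sqrt_le {a b x y r : ℝ} (hr : 0 < r) (hx : r ≤ x) (hy : r ≤ y)
    (ha : √(x ^ 2 + r ^ 2) ≤ a) (ha' : a ≤ x + r)
    (hb : √(y ^ 2 + r ^ 2) ≤ b) (hb' : b ≤ y + r) :
    a ^ 2 + b ^ 2 - (x ^ 2 + y ^ 2) ≤ 3 / 2 * (a * b) := by
  have key : ∀ t : ℝ, r ≤ t → √(t ^ 2 + r ^ 2) ^ 2 = t ^ 2 + r ^ 2 ∧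
      7 / 5 * r ≤ √(t ^ 2 + r ^ 2) := fun t ht =>
    ⟨Real.sq_sqrt (by positivity), Real.le_sqrt_of_sq_le (by nlinarith)⟩
  obtain ⟨hp, hp'⟩ := key x hx
  obtain ⟨hq, hq'⟩ := key y hy
  generalize √(x ^ 2 + r ^ 2) = p at *
  generalize √(y ^ 2 + r ^ 2) = q at *
  have corner₁ : p ^ 2 + q ^ 2 - (x ^ 2 + y ^ 2) ≤ 3 / 2 * (p * q) := by
    nlinarith [mul_le_mul hp' hq' (by positivity) (by linarith)]
  have corner₂ : p ^ 2 + (y + r) ^ 2 - (x ^ 2 + y ^ 2) ≤ 3 / 2 * (p * (y + r)) := by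
    nlinarith [mul_le_mul_of_nonneg_right hp' (show 0 ≤ y + r by linarith)]
  have corner₃ : (x + r) ^ 2 + q ^ 2 - (x ^ 2 + y ^ 2) ≤ 3 / 2 * ((x + r) * q) := by
    nlinarith [mul_le_mul_of_nonneg_right hq' (show 0 ≤ x + r by linarith)]
  have corner₄ : (x + r) ^ 2 + (y + r) ^ 2 - (x ^ 2 + y ^ 2) ≤ 3 / 2 * ((x + r) * (y + r)) := by
    nlinarith [mul_nonneg (sub_nonneg.2 hx) (sub_nonneg.2 hy),
      mul_nonneg hr.le (sub_nonneg.2 hx), mul_nonneg hr.le (sub_nonneg.2 hy)]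
  have edge : ∀ c s : ℝ, p ^ 2 + c ^ 2 - s ≤ 3 / 2 * (p * c) →
      (x + r) ^ 2 + c ^ 2 - s ≤ 3 / 2 * ((x + r) * c) →
      a ^ 2 + c ^ 2 - s ≤ 3 / 2 * (a * c) := fun c s h₁ h₂ => by
    linarith [sq_add_mul_add_nonpos_of_mem_Icc (β := -(3 / 2 * c)) (γ := c ^ 2 - s) ha ha'
      (by linarith) (by linarith)]
  linarith [sq_add_mul_add_nonpos_of_mem_Icc (β := -(3 / 2 * a))
    (γ := a ^ 2 - (x ^ 2 + y ^ 2)) hb hb'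
    (by linarith [edge q _ corner₁ corner₃]) (by linarith [edge (y + r) _ corner₂ corner₄])]

theorem inner_inv_norm_smul_le {E : Type*} [NormedAddCommGroup E] [InnerProductSpace ℝ E]
    {u v : E} {x y r : ℝ} (hr : 0 < r) (hx : r ≤ x) (hy : r ≤ y)
    (hu : √(x ^ 2 + r ^ 2) ≤ ‖u‖) (hu' : ‖u‖ ≤ x + r)
    (hv : √(y ^ 2 + r ^ 2) ≤ ‖v‖) (hv' : ‖v‖ ≤ y + r)
    (huv : √(x ^ 2 + y ^ 2) ≤ ‖u - v‖) :
    ⟪‖u‖⁻¹ • u, ‖v‖⁻¹ • v⟫ ≤ 3 / 4 := by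
  have hu0 : 0 < ‖u‖ := (Real.sqrt_pos.2 (by positivity)).trans_le hu
  have hv0 : 0 < ‖v‖ := (Real.sqrt_pos.2 (by positivity)).trans_le hv
  have h := sq_add_sq_sub_le_of_sqrt_le hr hx hy hu hu' hv hv'
  have hs : x ^ 2 + y ^ 2 ≤ ‖u - v‖ ^ 2 := (Real.sqrt_le_left (norm_nonneg _)).1 huv
  rw [norm_sub_sq_real] at hs
  rw [real_inner_smul_left, real_inner_smul_right, ← mul_assoc, ← mul_inv, inv_mul_le_iff₀
    (by positivity)]
  linarith

theorem stmt7 {n m N : ℕ} (hn : 2 ≤ n) (z : Fin m → EuclideanSpace ℝ (Fin (n - 1)))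
    (d : Fin m → ℝ) (hd : ∀ i, 0 < d i)
    (hzd : ∀ i j, i ≠ j →
      Real.sqrt (d i ^ 2 + d j ^ 2) ≤ ‖z i - z j‖ ∧ ‖z i - z j‖ ≤ d i + d j)
    (hN : ∀ S : Finset (EuclideanSpace ℝ (Fin (n - 1))),
      (∀ v ∈ S, ‖v‖ = 1) → (∀ v ∈ S, ∀ w ∈ S, v ≠ w → ⟪v, w⟫ ≤ 3 / 4) →
      S.card ≤ N) :
    m ≤ N + 1 := by
  classical
  rcases Nat.eq_zero_or_pos m with rfl | hm
  · exact Nat.zero_le _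
  have : Nonempty (Fin m) := ⟨⟨0, hm⟩⟩
  obtain ⟨k, hk⟩ := Finite.exists_min d
  let f : Fin m → EuclideanSpace ℝ (Fin (n - 1)) := fun i => ‖z i - z k‖⁻¹ • (z i - z k)
  have hunit : ∀ i ≠ k, ‖f i‖ = 1 := fun i hi => by
    have : 0 < ‖z i - z k‖ :=
      (Real.sqrt_pos.2 (by nlinarith [hd i, hd k])).trans_le (hzd i k hi).1
    exact norm_smul_inv_norm (𝕜 := ℝ) (norm_pos_iff.1 this)
  have hinner : ∀ i ≠ k, ∀ j ≠ k, i ≠ j → ⟪f i, f j⟫ ≤ 3 / 4 := fun i hi j hj hij =>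
    inner_inv_norm_smul_le (hd k) (hk i) (hk j) (hzd i k hi).1 (hzd i k hi).2
      (hzd j k hj).1 (hzd j k hj).2 (by simpa using (hzd i j hij).1)
  have hinj : Set.InjOn f (Finset.univ.erase k : Finset (Fin m)) := fun i hi j hj hij => by
    by_contra hne
    have hi' := Finset.ne_of_mem_erase hi
    have h := hinner i hi' j (Finset.ne_of_mem_erase hj) hne
    rw [← hij, real_inner_self_eq_norm_sq, hunit i hi'] at h
    norm_num at h
  have hcard := hN ((Finset.univ.erase k).image f)
    (by
      intro v hv
      obtain ⟨i, hi, rfl⟩ := Finset.mem_image.1 hv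
      exact hunit i (Finset.ne_of_mem_erase hi))
    (by
      intro v hv w hw hvw
      obtain ⟨i, hi, rfl⟩ := Finset.mem_image.1 hv
      obtain ⟨j, hj, rfl⟩ := Finset.mem_image.1 hw
      exact hinner i (Finset.ne_of_mem_erase hi) j (Finset.ne_of_mem_erase hj)
        fun h => hvw (h ▸ rfl))
  rw [Finset.card_image_of_injOn hinj, Finset.card_erase_of_mem (Finset.mem_univ k),
    Finset.card_univ, Fintype.card_fin] at hcard
  omega
end

section
/- Let n ≥ 2 and let 0 < φ < τ ≤ π be real numbers with √2·sin(φ/2) = sin(τ/2). Let z₁, …, z_m be distinct unit vectors in ℝ^{n−1} with cos τ ≤ ⟨z_i, z_j⟩ ≤ cos φ for all i ≠ j (i.e. a spherical code with all pairwise angles in [φ, τ]). Then there exist vectors h, w₁, …, w_m ∈ ℝⁿ × ℝ such that for all distinct indices i, j: I(h,h) > 0 > I(w_i,w_i), I(h,w_i) > 0, I(w_i,w_j) ≥ 0, and I(a·w_i + b·w_j, a·w_i + b·w_j) ≤ 0 for all real a, b ≥ 0. Consequently K_{n−1}(φ,τ) ≤ R_n(π/2), the strict hyperbolic kissing number. 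-/
open scoped RealInnerProductSpace

/-- Up to scale, the vector of the sphere in `ℝᵏ` with centre the unit vector `x` and squared
radius `s`. -/
noncomputable def sphereVector {k : ℕ} (s : ℝ) (x : EuclideanSpace ℝ (Fin k)) :
    EuclideanSpace ℝ (Fin (k + 1)) × ℝ :=
  (WithLp.toLp 2 (Fin.cons (-(s / 2)) x : Fin (k + 1) → ℝ), 1 - s / 2)

theorem minkI_sphereVector {k : ℕ} (s : ℝ) (x y : EuclideanSpace ℝ (Fin k)) :
    minkI (sphereVector s x) (sphereVector s y) = 1 - s - ⟪x, y⟫ := by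
  simp only [minkI, sphereVector, PiLp.inner_apply, Fin.sum_univ_succ, Fin.cons_zero,
    Fin.cons_succ, RCLike.inner_apply, conj_trivial]
  ring

theorem minkI_smul_add_smul_self {n : ℕ} (v w : EuclideanSpace ℝ (Fin n) × ℝ) (a b : ℝ) :
    minkI (a • v + b • w) (a • v + b • w) =
      a ^ 2 * minkI v v + 2 * (a * b) * minkI v w + b ^ 2 * minkI w w := by
  simp only [minkI, Prod.fst_add, Prod.snd_add, Prod.smul_fst, Prod.smul_snd, inner_add_left,
    inner_add_right, real_inner_smul_left, real_inner_smul_right, smul_eq_mul,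
    real_inner_comm v.1 w.1]
  ring

theorem stmt8 {n m : ℕ} (hn : 2 ≤ n) (φ τ : ℝ)
    (hφ : 0 < φ) (hφτ : φ < τ) (hτ : τ ≤ Real.pi)
    (hsin : Real.sqrt 2 * Real.sin (φ / 2) = Real.sin (τ / 2))
    (z : Fin m → EuclideanSpace ℝ (Fin (n - 1))) (hzinj : Function.Injective z)
    (hunit : ∀ i, ‖z i‖ = 1)
    (hcode : ∀ i j, i ≠ j → Real.cos τ ≤ ⟪z i, z j⟫ ∧ ⟪z i, z j⟫ ≤ Real.cos φ) :
    ∃ (h : EuclideanSpace ℝ (Fin n) × ℝ) (w : Fin m → EuclideanSpace ℝ (Fin n) × ℝ),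
      0 < minkI h h ∧ (∀ i, minkI (w i) (w i) < 0) ∧ (∀ i, 0 < minkI h (w i)) ∧
      ∀ i j, i ≠ j → 0 ≤ minkI (w i) (w j) ∧
        ∀ a b : ℝ, 0 ≤ a → 0 ≤ b →
          minkI (a • w i + b • w j) (a • w i + b • w j) ≤ 0 := by
  obtain ⟨k, rfl⟩ : ∃ k, n = k + 1 := ⟨n - 1, by omega⟩
  change Fin m → EuclideanSpace ℝ (Fin k) at z
  set s := Real.sin (τ / 2) ^ 2 with hs
  have hs_pos : 0 < s :=
    pow_pos (Real.sin_pos_of_pos_of_lt_pi (by linarith) (by linarith [Real.pi_pos])) 2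
  have hs_le : s ≤ 1 := Real.sin_sq_le_one _
  have hcosτ : Real.cos τ = 1 - 2 * s := by
    rw [hs, Real.sin_sq_eq_half_sub, mul_div_cancel₀ τ two_ne_zero]
    ring
  have hcosφ : Real.cos φ = 1 - s := by
    rw [hs, ← hsin, mul_pow, Real.sq_sqrt zero_le_two, Real.sin_sq_eq_half_sub,
      mul_div_cancel₀ φ two_ne_zero]
    ring
  have hself (i : Fin m) : minkI (sphereVector s (z i)) (sphereVector s (z i)) = -s := by
    rw [minkI_sphereVector, real_inner_self_eq_norm_sq, hunit i]
    ring
  refine ⟨(0, 1), fun i => sphereVector s (z i), by simp [minkI], fun i => ?_, fun i => ?_,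
    fun i j hij => ?_⟩
  · rw [hself]
    linarith
  · simp only [minkI, sphereVector, inner_zero_left]
    linarith
  · obtain ⟨hlower, hupper⟩ := hcode i j hij
    refine ⟨by rw [minkI_sphereVector]; linarith, fun a b ha hb => ?_⟩
    have hle : minkI (sphereVector s (z i)) (sphereVector s (z j)) ≤ s := by
      rw [minkI_sphereVector]
      linarith
    rw [minkI_smul_add_smul_self, hself, hself]
    nlinarith [mul_le_mul_of_nonneg_left hle (mul_nonneg ha hb),
      mul_nonneg hs_pos.le (sq_nonneg (a - b))]
end

section
/- Let φ₀ = arccos(3/4) and let S' = {r₁, …, r_ℓ} be a finite set of unit vectors in a real Euclidean space such that the angle between r_i and r_j is at least 2φ₀ for all i ≠ j (equivalently ⟨r_i, r_j⟩ ≤ cos(2φ₀) = 1/8). Then there exists a subset S ⊆ S' with |S| ≥ ℓ/2 such that for all distinct x, y ∈ S the angle between x and y is at most π − φ₀, i.e. ⟨x, y⟩ ≥ −3/4. In particular all pairwise angles of S lie in the interval [2φ₀, π − φ₀]. -/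
open scoped RealInnerProductSpace

/-- Two unit vectors that are both nearly antipodal to a third one are close to each other. -/
theorem one_eighth_lt_inner_of_inner_lt {E : Type*} [NormedAddCommGroup E]
    [InnerProductSpace ℝ E] {x y z : E} (hx : ‖x‖ = 1) (hy : ‖y‖ = 1) (hz : ‖z‖ = 1)
    (hxy : ⟪x, y⟫ < -(3 / 4 : ℝ)) (hxz : ⟪x, z⟫ < -(3 / 4 : ℝ)) : 1 / 8 < ⟪y, z⟫ := by
  have h := abs_real_inner_le_norm x (y + z)
  rw [hx, one_mul, inner_add_right] at h
  have h₁ := norm_add_sq_real y z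
  rw [hy, hz] at h₁
  have h₂ := (abs_le.1 h).1
  nlinarith

/-- A finite set on which a symmetric relation relates each element to at most one other element
has a subset of at least half its size containing no two distinct related elements. -/
theorem Finset.exists_subset_card_le_two_mul_of_matching {α : Type*} {r : α → α → Prop}
    (hr : ∀ x y, r x y → r y x) (T : Finset α)
    (hT : ∀ x ∈ T, ∀ y ∈ T, ∀ z ∈ T, x ≠ y → x ≠ z → r x y → r x z → y = z) :
    ∃ S ⊆ T, T.card ≤ 2 * S.card ∧ ∀ x ∈ S, ∀ y ∈ S, x ≠ y → ¬ r x y := by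
  classical
  induction T using Finset.strongInduction with
  | H T ih =>
    by_cases h : ∀ x ∈ T, ∀ y ∈ T, x ≠ y → ¬ r x y
    · exact ⟨T, subset_rfl, by omega, h⟩
    push Not at h
    obtain ⟨x, hx, y, hy, hxy, hrxy⟩ := h
    have hyx : y ∈ T.erase x := Finset.mem_erase.2 ⟨hxy.symm, hy⟩
    have hsub : (T.erase x).erase y ⊆ T :=
      (Finset.erase_subset _ _).trans (Finset.erase_subset _ _)
    obtain ⟨S, hS, hcard, hindep⟩ := ih ((T.erase x).erase y)
      ((Finset.erase_ssubset hyx).trans_subset (Finset.erase_subset _ _))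
      (fun a ha b hb c hc => hT a (hsub ha) b (hsub hb) c (hsub hc))
    have hxS : x ∉ S := fun h => by simpa using hS h
    have hnr : ∀ z ∈ S, ¬ r x z := by
      intro z hz hrxz
      have hz' := hS hz
      simp only [Finset.mem_erase] at hz'
      exact hz'.1 (hT x hx y hy z hz'.2.2 hxy hz'.2.1.symm hrxy hrxz).symm
    refine ⟨insert x S, Finset.insert_subset hx (hS.trans hsub), ?_, ?_⟩
    · have h₁ := Finset.card_erase_add_one hx
      have h₂ := Finset.card_erase_add_one hyx
      rw [Finset.card_insert_of_notMem hxS]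
      omega
    · intro a ha b hb hab hrab
      rcases Finset.mem_insert.1 ha with rfl | haS
      · exact hnr b ((Finset.mem_insert.1 hb).resolve_left hab.symm) hrab
      · rcases Finset.mem_insert.1 hb with rfl | hbS
        · exact hnr a haS (hr _ _ hrab)
        · exact hindep a haS b hbS hab hrab

theorem stmt9 {E : Type*} [NormedAddCommGroup E] [InnerProductSpace ℝ E]
    [FiniteDimensional ℝ E] (S' : Finset E)
    (hunit : ∀ r ∈ S', ‖r‖ = 1)
    (hsep : ∀ r ∈ S', ∀ s ∈ S', r ≠ s → ⟪r, s⟫ ≤ 1 / 8) :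
    ∃ S ⊆ S', S'.card ≤ 2 * S.card ∧
      ∀ x ∈ S, ∀ y ∈ S, x ≠ y → -(3 / 4 : ℝ) ≤ ⟪x, y⟫ := by
  obtain ⟨S, hS, hcard, h⟩ := S'.exists_subset_card_le_two_mul_of_matching
    (r := fun x y => ⟪x, y⟫ < -(3 / 4 : ℝ))
    (fun x y hxy => by rwa [real_inner_comm])
    (fun x hx y hy z hz _ _ hxy hxz => by
      by_contra hyz
      exact (hsep y hy z hz hyz).not_gt
        (one_eighth_lt_inner_of_inner_lt (hunit x hx) (hunit y hy) (hunit z hz) hxy hxz))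
  exact ⟨S, hS, hcard, fun x hx y hy hxy => not_lt.1 (h x hx y hy hxy)⟩
end

section
/- Let α, β, γ be real numbers with α < 0, γ < 0 and β ≥ 0, and suppose there exist real numbers a, b ≥ 0 with α·a² + 2β·a·b + γ·b² > 0. Then β > 0 and β² > α·γ, and there exist positive integers p and q such that p·α + q·β > 0 and p·β + q·γ > 0. -/
theorem stmt11 (α β γ : ℝ) (hα : α < 0) (hγ : γ < 0) (hβ : 0 ≤ β)
    (hab : ∃ a b : ℝ, 0 ≤ a ∧ 0 ≤ b ∧ 0 < α * a ^ 2 + 2 * β * a * b + γ * b ^ 2) :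
    0 < β ∧ α * γ < β ^ 2 ∧
      ∃ p q : ℤ, 0 < p ∧ 0 < q ∧
        0 < (p : ℝ) * α + (q : ℝ) * β ∧ 0 < (p : ℝ) * β + (q : ℝ) * γ := by
  obtain ⟨a, b, -, -, h⟩ := hab
  have hdisc : α * γ < β ^ 2 := by
    by_contra! hle
    have hneg := mul_neg_of_neg_of_pos hα h
    nlinarith [sq_nonneg (α * a + β * b), mul_nonneg (sub_nonneg.2 hle) (sq_nonneg b)]
  have hβ' : 0 < β := by
    refine hβ.lt_of_ne fun h0 => ?_
    subst h0
    nlinarith [mul_pos_of_neg_of_neg hα hγ]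
  refine ⟨hβ', hdisc, ?_⟩
  have hlt : -γ / β < β / -α := by
    rw [div_lt_div_iff₀ hβ' (neg_pos.2 hα)]
    linarith
  obtain ⟨r, hr₁, hr₂⟩ := exists_rat_btwn hlt
  have hr : 0 < r := by
    exact_mod_cast (div_pos (neg_pos.2 hγ) hβ').trans hr₁
  have hq : (0 : ℝ) < r.den := by exact_mod_cast r.den_pos
  rw [Rat.cast_def, div_lt_div_iff₀ hβ' hq] at hr₁
  rw [Rat.cast_def, div_lt_div_iff₀ hq (neg_pos.2 hα)] at hr₂
  refine ⟨r.num, r.den, Rat.num_pos.2 hr, by exact_mod_cast r.den_pos, ?_, ?_⟩ <;>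
    push_cast <;> linarith
end

section
/- Let n ≥ 2 and let w₁, …, w_{m'} ∈ ℝⁿ × ℝ be distinct negative vectors for the Minkowski form I such that for all i ≠ j: I(w_i,w_j) ≥ 0 and I(a·w_i + b·w_j, a·w_i + b·w_j) ≤ 0 for all real a, b ≥ 0 (a possibly nonstrict hyperbolic code of angle at least π/2 with m' elements). Set m = ⌈m'/2⌉. Then there exist vectors h, u₁, …, u_m ∈ ℝⁿ × ℝ such that for all distinct indices i, j: I(h,h) > 0 > I(u_i,u_i), I(h,u_i) > 0, I(u_i,u_j) ≥ 0, and I(a·u_i + b·u_j, a·u_i + b·u_j) ≤ 0 for all real a, b ≥ 0; that is, there is a strict hyperbolic code of angle at least π/2 with at least ⌈m'/2⌉ elements. Consequently R_n(π/2) ≤ R̄_n(π/2) ≤ 2·R_n(π/2). -/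
open scoped RealInnerProductSpace

/-- Finitely many negative vectors all pair nontrivially with some common positive vector. -/
theorem exists_minkI_pos_forall_ne_zero {n : ℕ} {ι : Type*} [Finite ι]
    (w : ι → EuclideanSpace ℝ (Fin n) × ℝ) (hneg : ∀ i, minkI (w i) (w i) < 0) :
    ∃ h : EuclideanSpace ℝ (Fin n) × ℝ, 0 < minkI h h ∧ ∀ i, minkI h (w i) ≠ 0 := by
  have hw : ∀ i, (w i).1 ≠ 0 := by
    intro i hi
    have := hneg i
    simp only [minkI, hi, inner_zero_left] at this
    nlinarith [mul_self_nonneg (w i).2]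
  obtain ⟨v, hv⟩ := Module.Dual.exists_forall_ne_zero_of_forall_exists
    (fun i => (innerSL ℝ (w i).1 : EuclideanSpace ℝ (Fin n) →ₗ[ℝ] ℝ))
    (fun i => ⟨(w i).1, by simpa using hw i⟩)
  have hfin : (Set.range fun i => (w i).2 / ⟪v, (w i).1⟫).Finite := Set.finite_range _
  have hε : (0 : ℝ) < (‖v‖ + 1)⁻¹ := by positivity
  obtain ⟨t, ⟨ht0, ht1⟩, ht⟩ := ((Set.Ioo_infinite hε).sdiff hfin).nonempty
  refine ⟨(t • v, 1), ?_, fun i hi => ht ⟨i, ?_⟩⟩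
  · have h1 : t * ‖v‖ < 1 := by
      have := mul_lt_mul_of_pos_right ht1 (by positivity : 0 < ‖v‖ + 1)
      rw [inv_mul_cancel₀ (by positivity)] at this
      linarith
    have h0 : 0 ≤ t * ‖v‖ := by positivity
    simp only [minkI, real_inner_self_eq_norm_sq, norm_smul, Real.norm_eq_abs, abs_of_pos ht0]
    nlinarith
  · have hvi : ⟪v, (w i).1⟫ ≠ 0 := by
      rw [real_inner_comm]
      exact hv i
    simp only [minkI, real_inner_smul_left] at hi
    rw [div_eq_iff hvi]
    linarith

/-- If no value of `f` vanishes, some sign choice makes at least half of the values positive. -/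
theorem exists_sign_embedding_forall_pos {k : ℕ} (f : Fin k → ℝ) (hf : ∀ i, f i ≠ 0) :
    ∃ (s : ℤˣ) (e : Fin ((k + 1) / 2) ↪ Fin k), ∀ i, 0 < ((s : ℤ) : ℝ) * f (e i) := by
  have key : ∀ S : Finset (Fin k), (k + 1) / 2 ≤ S.card →
      ∃ e : Fin ((k + 1) / 2) ↪ Fin k, ∀ i, e i ∈ S := by
    intro S hS
    obtain ⟨e⟩ : Nonempty (Fin ((k + 1) / 2) ↪ S) :=
      Function.Embedding.nonempty_of_card_le (by simpa using hS)
    exact ⟨e.trans (Function.Embedding.subtype _), fun i => (e i).2⟩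
  have hcard := Finset.card_filter_add_card_filter_not (s := Finset.univ) (fun i => 0 < f i)
  rw [Finset.card_univ, Fintype.card_fin] at hcard
  rcases le_or_gt ((k + 1) / 2) (Finset.univ.filter fun i => 0 < f i).card with hS | hS
  · obtain ⟨e, he⟩ := key _ hS
    exact ⟨1, e, fun i => by simpa using he i⟩
  · obtain ⟨e, he⟩ := key (Finset.univ.filter fun i => ¬ 0 < f i) (by omega)
    refine ⟨-1, e, fun i => ?_⟩
    have := lt_of_le_of_ne (not_lt.mp (Finset.mem_filter.mp (he i)).2) (hf _)
    simpa using this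

theorem stmt12 {n m' : ℕ} (hn : 2 ≤ n)
    (w : Fin m' → EuclideanSpace ℝ (Fin n) × ℝ) (hwinj : Function.Injective w)
    (hneg : ∀ i, minkI (w i) (w i) < 0)
    (hcode : ∀ i j, i ≠ j → 0 ≤ minkI (w i) (w j) ∧
      ∀ a b : ℝ, 0 ≤ a → 0 ≤ b →
        minkI (a • w i + b • w j) (a • w i + b • w j) ≤ 0) :
    ∃ (h : EuclideanSpace ℝ (Fin n) × ℝ)
      (u : Fin ((m' + 1) / 2) → EuclideanSpace ℝ (Fin n) × ℝ),
      0 < minkI h h ∧ (∀ i, minkI (u i) (u i) < 0) ∧ (∀ i, 0 < minkI h (u i)) ∧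
      ∀ i j, i ≠ j → 0 ≤ minkI (u i) (u j) ∧
        ∀ a b : ℝ, 0 ≤ a → 0 ≤ b →
          minkI (a • u i + b • u j) (a • u i + b • u j) ≤ 0 := by
  obtain ⟨h, hpos, hne⟩ := exists_minkI_pos_forall_ne_zero w hneg
  obtain ⟨s, e, he⟩ := exists_sign_embedding_forall_pos (fun i => minkI h (w i)) hne
  refine ⟨((s : ℤ) : ℝ) • h, w ∘ e, ?_, fun i => hneg _, fun i => ?_,
    fun i j hij => hcode _ _ (e.injective.ne hij)⟩
  · rcases Int.units_eq_one_or s with rfl | rfl <;> simpa [minkI] using hpos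
  · have := he i
    rcases Int.units_eq_one_or s with rfl | rfl <;>
      simp only [minkI, Function.comp_apply, Prod.smul_fst, Prod.smul_snd, smul_eq_mul,
        real_inner_smul_left] at this ⊢ <;> linarith
end

section
/- Let n ≥ 2 and suppose h, w₀, w₁, …, w_m ∈ ℝⁿ × ℝ satisfy, for all distinct indices 0 ≤ i, j ≤ m: I(h,h) > 0 > I(w_i,w_i), I(h,w_i) > 0, I(w_i,w_j) ≥ 0, and I(a·w_i + b·w_j, a·w_i + b·w_j) ≤ 0 for all real a, b ≥ 0. Suppose N is a natural number such that every finite set of unit vectors in ℝ^{n−1} with pairwise inner products at most 3/4 has cardinality at most N. Then m + 1 ≤ N + 2. (In the notation of the paper, the strict hyperbolic kissing number satisfies R_n(π/2) ≤ K_{n−1}(arccos(3/4)) + 2.) -/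
open scoped RealInnerProductSpace

section MinkowskiForm

variable {n : ℕ}

lemma minkI_add_left_s13 (x y z : EuclideanSpace ℝ (Fin n) × ℝ) :
    minkI (x + y) z = minkI x z + minkI y z := by
  simp only [minkI, Prod.fst_add, Prod.snd_add, inner_add_left]
  ring

lemma minkI_smul_left_s13 (a : ℝ) (x z : EuclideanSpace ℝ (Fin n) × ℝ) :
    minkI (a • x) z = a * minkI x z := by
  simp only [minkI, Prod.smul_fst, Prod.smul_snd, real_inner_smul_left, smul_eq_mul]
  ring

lemma minkI_comm_s13 (x y : EuclideanSpace ℝ (Fin n) × ℝ) : minkI x y = minkI y x := by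
  simp only [minkI, real_inner_comm, mul_comm]

lemma minkI_add_right_s13 (x y z : EuclideanSpace ℝ (Fin n) × ℝ) :
    minkI z (x + y) = minkI z x + minkI z y := by
  rw [minkI_comm_s13, minkI_add_left_s13, minkI_comm_s13 x, minkI_comm_s13 y]

lemma minkI_smul_right_s13 (a : ℝ) (x z : EuclideanSpace ℝ (Fin n) × ℝ) :
    minkI z (a • x) = a * minkI z x := by
  rw [minkI_comm_s13, minkI_smul_left_s13, minkI_comm_s13 x]

lemma minkI_sub_left (x y z : EuclideanSpace ℝ (Fin n) × ℝ) :
    minkI (x - y) z = minkI x z - minkI y z := by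
  simp only [minkI, Prod.fst_sub, Prod.snd_sub, inner_sub_left]
  ring

lemma minkI_sub_right (x y z : EuclideanSpace ℝ (Fin n) × ℝ) :
    minkI z (x - y) = minkI z x - minkI z y := by
  rw [minkI_comm_s13, minkI_sub_left, minkI_comm_s13 x, minkI_comm_s13 y]

/-- A ray from a timelike vector in a spacelike direction meets the light cone. -/
lemma exists_pos_minkI_add_smul_self_eq_zero {h x : EuclideanSpace ℝ (Fin n) × ℝ}
    (hh : 0 < minkI h h) (hx : minkI x x < 0) :
    ∃ t : ℝ, 0 < t ∧ minkI (h + t • x) (h + t • x) = 0 := by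
  set a := minkI h h
  set b := minkI h x
  set c := -minkI x x with hc
  have hc0 : 0 < c := by linarith
  have hd : b ^ 2 < b ^ 2 + a * c := by nlinarith [mul_pos hh hc0]
  have hd0 : 0 ≤ b ^ 2 + a * c := by positivity
  have hlt : |b| < √(b ^ 2 + a * c) := by
    rw [← Real.sqrt_sq_eq_abs]
    exact Real.sqrt_lt_sqrt (sq_nonneg b) hd
  have hsq := Real.sq_sqrt hd0
  set d := √(b ^ 2 + a * c)
  refine ⟨(b + d) / c, div_pos (by linarith [neg_abs_le b]) hc0, ?_⟩
  have hexp : ∀ t : ℝ, minkI (h + t • x) (h + t • x) = a + 2 * t * b - t ^ 2 * c := by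
    intro t
    simp only [minkI_add_left_s13, minkI_add_right_s13, minkI_smul_left_s13, minkI_smul_right_s13,
      minkI_comm_s13 x h, a, b, c]
    ring
  rw [hexp]
  field_simp
  linear_combination -hsq

/-- The quotient of the orthogonal complement of a nonzero lightlike vector by its span is
Euclidean of dimension `n - 1`. -/
lemma exists_inner_eq_neg_minkI (hn : 1 ≤ n) {e : EuclideanSpace ℝ (Fin n) × ℝ}
    (he : minkI e e = 0) (he0 : e ≠ 0) :
    ∃ f : EuclideanSpace ℝ (Fin n) × ℝ → EuclideanSpace ℝ (Fin (n - 1)),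
      ∀ x y, minkI x e = 0 → minkI y e = 0 → ⟪f x, f y⟫ = -minkI x y := by
  obtain ⟨v, u⟩ := e
  have hvu : ⟪v, v⟫ = u * u := by
    simp only [minkI] at he
    linarith
  have hu : u ≠ 0 := by
    rintro rfl
    apply he0
    have : v = 0 := by
      rw [← inner_self_eq_zero (𝕜 := ℝ), hvu, mul_zero]
    simp [this]
  have hv : v ≠ 0 := by
    rintro rfl
    simp [hu] at hvu
  have : Fact (Module.finrank ℝ (EuclideanSpace ℝ (Fin n)) = (n - 1) + 1) :=
    ⟨by simp; omega⟩
  let b := OrthonormalBasis.fromOrthogonalSpanSingleton (𝕜 := ℝ) (n - 1) hv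
  have hmem : ∀ x : EuclideanSpace ℝ (Fin n), x - (⟪v, x⟫ / (u * u)) • v ∈ (ℝ ∙ v)ᗮ := by
    intro x
    rw [Submodule.mem_orthogonal_singleton_iff_inner_right, inner_sub_right,
      real_inner_smul_right, hvu]
    field_simp
    ring
  refine ⟨fun x => b.repr ⟨_, hmem x.1⟩, ?_⟩
  rintro ⟨x, s⟩ ⟨y, t⟩ hx hy
  simp only [minkI] at hx hy ⊢
  rw [real_inner_comm] at hx hy
  have hx' : ⟪v, x⟫ = s * u := by linarith
  have hy' : ⟪v, y⟫ = t * u := by linarith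
  simp only [LinearIsometryEquiv.inner_map_map, Submodule.coe_inner, inner_sub_left,
    inner_sub_right, real_inner_smul_left, real_inner_smul_right, real_inner_comm v x, hx', hy',
    hvu]
  field_simp
  ring

end MinkowskiForm

lemma sixteen_mul_sq_le_of_one_le {r s g k : ℝ} (hr : 1 ≤ r) (hs : 1 ≤ s)
    (hg : 0 ≤ g) (hgr : g ≤ r) (hk : 0 ≤ k) (hks : k ≤ s) :
    16 * (1 + g + k) ^ 2 ≤ 9 * ((r ^ 2 + 1 + 2 * g) * (s ^ 2 + 1 + 2 * k)) := by
  have key : ∀ {g k A B : ℝ}, 0 ≤ g → 0 ≤ k → k ≤ 1 → 2 + 2 * g ≤ A → (1 + g) ^ 2 ≤ A →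
      2 + 2 * k ≤ B → 16 * (1 + g + k) ^ 2 ≤ 9 * (A * B) := by
    intro g k A B hg hk hk1 hA hA' hB
    have hA0 : 0 ≤ A := (sq_nonneg _).trans hA'
    rcases le_total g 1 with hg1 | hg1
    · have : (2 + 2 * g) * (2 + 2 * k) ≤ A * B := by gcongr
      nlinarith [mul_nonneg hg (sub_nonneg.2 hg1), mul_nonneg hk (sub_nonneg.2 hk1),
        mul_nonneg hg hk, mul_nonneg (sub_nonneg.2 hg1) (sub_nonneg.2 hk1)]
    · have h1 : (1 + g) ^ 2 * (2 + 2 * k) ≤ A * B := by gcongr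
      have h2 : 1 + g + k ≤ (1 + g) * (1 + k / 2) := by nlinarith
      have h3 : (1 + g + k) ^ 2 ≤ ((1 + g) * (1 + k / 2)) ^ 2 := by gcongr
      have h4 : 16 * (1 + k / 2) ^ 2 ≤ 9 * (2 + 2 * k) := by nlinarith
      have h5 := mul_le_mul_of_nonneg_left h4 (sq_nonneg (1 + g))
      nlinarith
  have hA : 2 + 2 * g ≤ r ^ 2 + 1 + 2 * g := by nlinarith
  have hA' : (1 + g) ^ 2 ≤ r ^ 2 + 1 + 2 * g := by nlinarith
  have hB : 2 + 2 * k ≤ s ^ 2 + 1 + 2 * k := by nlinarith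
  have hB' : (1 + k) ^ 2 ≤ s ^ 2 + 1 + 2 * k := by nlinarith
  rcases le_total k 1 with hk1 | hk1
  · exact key hg hk hk1 hA hA' hB
  rcases le_total g 1 with hg1 | hg1
  · have := key hk hg hg1 hB hB' hA
    linarith
  · have h1 : (1 + g) ^ 2 * (1 + k) ^ 2 ≤ (r ^ 2 + 1 + 2 * g) * (s ^ 2 + 1 + 2 * k) := by gcongr
    have h2 : 4 * (1 + g + k) ≤ 3 * ((1 + g) * (1 + k)) := by nlinarith
    have h3 : (4 * (1 + g + k)) ^ 2 ≤ (3 * ((1 + g) * (1 + k))) ^ 2 := by gcongr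
    nlinarith

lemma sixteen_mul_sq_le_of_le {t r s g k : ℝ} (ht : 0 < t) (hr : t ≤ r) (hs : t ≤ s)
    (hg : 0 ≤ g) (hgr : g ≤ r * t) (hk : 0 ≤ k) (hks : k ≤ s * t) :
    16 * (t ^ 2 + g + k) ^ 2 ≤ 9 * ((r ^ 2 + t ^ 2 + 2 * g) * (s ^ 2 + t ^ 2 + 2 * k)) := by
  have h := sixteen_mul_sq_le_of_one_le (r := r / t) (s := s / t) (g := g / t ^ 2)
    (k := k / t ^ 2) ((one_le_div ht).2 hr) ((one_le_div ht).2 hs) (by positivity)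
    (by rw [div_le_div_iff₀ (by positivity) ht]; nlinarith) (by positivity)
    (by rw [div_le_div_iff₀ (by positivity) ht]; nlinarith)
  have h' := mul_le_mul_of_nonneg_left h (by positivity : 0 ≤ t ^ 4)
  calc 16 * (t ^ 2 + g + k) ^ 2 = t ^ 4 * (16 * (1 + g / t ^ 2 + k / t ^ 2) ^ 2) := by
        field_simp
    _ ≤ _ := h'
    _ = _ := by field_simp

/-- Balls of radii `r i` in `ℝᵈ` that pairwise overlap at non-obtuse angles or touch, given by the
vectors `p i` from the center of a smallest ball, of radius `t`, to the other centers. -/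
lemma card_le_of_inner_eq {ι : Type*} [Fintype ι] {d N : ℕ}
    (hN : ∀ S : Finset (EuclideanSpace ℝ (Fin d)),
      (∀ v ∈ S, ‖v‖ = 1) → (∀ v ∈ S, ∀ u ∈ S, v ≠ u → ⟪v, u⟫ ≤ 3 / 4) → S.card ≤ N)
    (p : ι → EuclideanSpace ℝ (Fin d)) {t : ℝ} (ht : 0 < t) (r g : ι → ℝ)
    (hr : ∀ i, t ≤ r i) (hg : ∀ i, 0 ≤ g i) (hgr : ∀ i, g i ≤ r i * t)
    (hp : ∀ i, ⟪p i, p i⟫ = r i ^ 2 + t ^ 2 + 2 * g i)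
    (hpp : ∀ i j, i ≠ j → ⟪p i, p j⟫ ≤ t ^ 2 + g i + g j) :
    Fintype.card ι ≤ N := by
  classical
  have hpos : ∀ i, 0 < ‖p i‖ := by
    intro i
    have h1 := hp i
    rw [real_inner_self_eq_norm_sq] at h1
    have h2 : 0 < ‖p i‖ ^ 2 := by rw [h1]; have := hg i; positivity
    exact (norm_nonneg _).lt_of_ne' (pow_ne_zero_iff two_ne_zero |>.1 h2.ne')
  let q : ι → EuclideanSpace ℝ (Fin d) := fun i => ‖p i‖⁻¹ • p i
  have hq : ∀ i, ‖q i‖ = 1 := fun i => by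
    simp [q, norm_smul, (hpos i).ne']
  have hqq : ∀ i j, i ≠ j → ⟪q i, q j⟫ ≤ 3 / 4 := by
    intro i j hij
    have h1 := sixteen_mul_sq_le_of_le ht (hr i) (hr j) (hg i) (hgr i) (hg j) (hgr j)
    rw [← hp i, ← hp j, real_inner_self_eq_norm_sq, real_inner_self_eq_norm_sq] at h1
    have h2 : 4 * (t ^ 2 + g i + g j) ≤ 3 * (‖p i‖ * ‖p j‖) := by
      refine abs_le_of_sq_le_sq' ?_ (by positivity) |>.2
      nlinarith
    have h3 := hpp i j hij
    simp only [q, real_inner_smul_left, real_inner_smul_right]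
    rw [← mul_assoc, ← mul_inv, inv_mul_le_iff₀ (mul_pos (hpos j) (hpos i))]
    linarith
  have hinj : Function.Injective q := by
    intro i j hij
    by_contra hne
    have h1 := hqq i j hne
    rw [hij, real_inner_self_eq_norm_sq, hq] at h1
    norm_num at h1
  have h := hN (Finset.univ.image q) (by simp [hq]) (by
    simp only [Finset.mem_image, Finset.mem_univ, true_and]
    rintro _ ⟨i, rfl⟩ _ ⟨j, rfl⟩ hne
    exact hqq i j fun h => hne (h ▸ rfl))
  rwa [Finset.card_image_of_injective _ hinj, Finset.card_univ] at h

/-- A strict hyperbolic code seen from a lightlike vector `e`. -/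
lemma card_le_of_lightlike {ι : Type*} [Fintype ι] {n N : ℕ} (hn : 1 ≤ n)
    (hN : ∀ S : Finset (EuclideanSpace ℝ (Fin (n - 1))),
      (∀ v ∈ S, ‖v‖ = 1) → (∀ v ∈ S, ∀ u ∈ S, v ≠ u → ⟪v, u⟫ ≤ 3 / 4) → S.card ≤ N)
    {e : EuclideanSpace ℝ (Fin n) × ℝ} (he : minkI e e = 0)
    (w : ι → EuclideanSpace ℝ (Fin n) × ℝ)
    (hneg : ∀ i, minkI (w i) (w i) < 0) (hpos : ∀ i, 0 < minkI e (w i))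
    (hcode : ∀ i j, i ≠ j → 0 ≤ minkI (w i) (w j) ∧
      ∀ a b : ℝ, 0 ≤ a → 0 ≤ b →
        minkI (a • w i + b • w j) (a • w i + b • w j) ≤ 0) :
    Fintype.card ι ≤ N + 1 := by
  classical
  rcases isEmpty_or_nonempty ι with hι | hι
  · simp
  let x : ι → EuclideanSpace ℝ (Fin n) × ℝ := fun i => (minkI e (w i))⁻¹ • w i
  have hxe : ∀ i, minkI (x i) e = 1 := by
    intro i
    rw [minkI_smul_left_s13, minkI_comm_s13 (w i), inv_mul_cancel₀ (hpos i).ne']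
  have hxx : ∀ i, minkI (x i) (x i) < 0 := by
    intro i
    rw [minkI_smul_left_s13, minkI_smul_right_s13]
    have := inv_pos.2 (hpos i)
    exact mul_neg_of_pos_of_neg this (mul_neg_of_pos_of_neg this (hneg i))
  let r : ι → ℝ := fun i => √(-minkI (x i) (x i))
  have hr : ∀ i, 0 < r i := fun i => Real.sqrt_pos.2 (by linarith [hxx i])
  have hrr : ∀ i, minkI (x i) (x i) = -(r i ^ 2) := fun i => by
    rw [Real.sq_sqrt (by linarith [hxx i]), neg_neg]
  have hxy : ∀ i j, i ≠ j → 0 ≤ minkI (x i) (x j) := by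
    intro i j hij
    rw [minkI_smul_left_s13, minkI_smul_right_s13]
    have := inv_pos.2 (hpos i)
    have := inv_pos.2 (hpos j)
    have := (hcode i j hij).1
    positivity
  have hxy' : ∀ i j, i ≠ j → minkI (x i) (x j) ≤ r i * r j := by
    intro i j hij
    have h1 := (hcode i j hij).2 (r j * (minkI e (w i))⁻¹) (r i * (minkI e (w j))⁻¹)
      (mul_nonneg (hr j).le (inv_pos.2 (hpos i)).le) (mul_nonneg (hr i).le (inv_pos.2 (hpos j)).le)
    rw [mul_smul, mul_smul] at h1
    change minkI (r j • x i + r i • x j) (r j • x i + r i • x j) ≤ 0 at h1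
    simp only [minkI_add_left_s13, minkI_add_right_s13, minkI_smul_left_s13, minkI_smul_right_s13, hrr,
      minkI_comm_s13 (x j) (x i)] at h1
    have h2 : r i * r j * minkI (x i) (x j) ≤ r i * r j * (r i * r j) := by linarith
    exact le_of_mul_le_mul_left h2 (mul_pos (hr i) (hr j))
  obtain ⟨o, ho⟩ := Finite.exists_min r
  have he0 : e ≠ 0 := by
    rintro rfl
    have := hpos o
    simp [minkI] at this
  obtain ⟨f, hf⟩ := exists_inner_eq_neg_minkI hn he he0
  have hperp : ∀ i, minkI (x i - x o) e = 0 := by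
    intro i
    rw [minkI_sub_left, hxe, hxe, sub_self]
  have h := card_le_of_inner_eq (ι := {i // i ≠ o}) hN (fun i => f (x i - x o)) (hr o)
    (fun i => r i) (fun i => minkI (x i) (x o)) (fun i => ho i) (fun i => hxy i o i.2)
    (fun i => hxy' i o i.2)
    (fun i => by
      simp only [hf _ _ (hperp _) (hperp _), minkI_sub_left, minkI_sub_right, hrr,
        minkI_comm_s13 (x o) (x i)]
      ring)
    (fun i j hij => by
      have := hxy i j fun h => hij (Subtype.ext h)
      simp only [hf _ _ (hperp _) (hperp _), minkI_sub_left, minkI_sub_right, hrr,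
        minkI_comm_s13 (x o) (x j)]
      linarith)
  rw [Fintype.card_subtype_compl, Fintype.card_subtype_eq] at h
  omega

theorem stmt13 {n m N : ℕ} (hn : 2 ≤ n)
    (h : EuclideanSpace ℝ (Fin n) × ℝ)
    (w : Fin (m + 1) → EuclideanSpace ℝ (Fin n) × ℝ)
    (hh : 0 < minkI h h) (hneg : ∀ i, minkI (w i) (w i) < 0)
    (hpos : ∀ i, 0 < minkI h (w i))
    (hcode : ∀ i j, i ≠ j → 0 ≤ minkI (w i) (w j) ∧
      ∀ a b : ℝ, 0 ≤ a → 0 ≤ b →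
        minkI (a • w i + b • w j) (a • w i + b • w j) ≤ 0)
    (hN : ∀ S : Finset (EuclideanSpace ℝ (Fin (n - 1))),
      (∀ v ∈ S, ‖v‖ = 1) → (∀ v ∈ S, ∀ u ∈ S, v ≠ u → ⟪v, u⟫ ≤ 3 / 4) →
      S.card ≤ N) :
    m + 1 ≤ N + 2 := by
  obtain ⟨t, ht, he⟩ := exists_pos_minkI_add_smul_self_eq_zero hh (hneg 0)
  have hcard := card_le_of_lightlike (by omega) hN he (fun i : Fin m => w i.succ)
    (fun i => hneg _)
    (fun i => by
      rw [minkI_add_left_s13, minkI_smul_left_s13]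
      have := hpos i.succ
      have := (hcode 0 i.succ (Fin.succ_ne_zero i).symm).1
      positivity)
    (fun i j hij => hcode _ _ fun h => hij (Fin.succ_injective _ h))
  rw [Fintype.card_fin] at hcard
  omega
end

section
/- Let n ≥ 2 and suppose h, w₀, w₁, …, w_m ∈ ℝⁿ × ℝ satisfy, for all distinct indices 0 ≤ i, j ≤ m: I(h,h) > 0 > I(w_i,w_i), I(h,w_i) > 0, I(w_i,w_j) ≥ 0, and I(a·w_i + b·w_j, a·w_i + b·w_j) ≤ 0 for all real a, b ≥ 0. Then there exist points z₁, …, z_m ∈ ℝ^{n−1} and positive reals d₀, d₁, …, d_m such that: (a) ‖z_j‖² > max(0, d_j² − d₀²) for 1 ≤ j ≤ m; (b) |d₀ − d_i| ≤ ‖z_i‖ ≤ √(d₀² + d_i²) for 1 ≤ i ≤ m; (c) √(d_i² + d_j²) ≤ ‖z_i − z_j‖ ≤ d_i + d_j for 1 ≤ i < j ≤ m. -/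
open scoped RealInnerProductSpace

section MinkowskiForm

variable {n : ℕ} (a b c : EuclideanSpace ℝ (Fin n) × ℝ) (t : ℝ)

lemma minkI_comm_s14 : minkI a b = minkI b a := by
  simp only [minkI, real_inner_comm, mul_comm]

lemma minkI_add_left_s14 : minkI (a + b) c = minkI a c + minkI b c := by
  simp only [minkI, Prod.fst_add, Prod.snd_add, inner_add_left]
  ring

lemma minkI_smul_left_s14 : minkI (t • a) b = t * minkI a b := by
  simp only [minkI, Prod.smul_fst, Prod.smul_snd, real_inner_smul_left, smul_eq_mul]
  ring

lemma minkI_add_right_s14 : minkI a (b + c) = minkI a b + minkI a c := by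
  simp only [minkI_comm_s14 a, minkI_add_left_s14]

lemma minkI_smul_right_s14 : minkI a (t • b) = t * minkI a b := by
  simp only [minkI_comm_s14 a, minkI_smul_left_s14]

lemma minkI_sub_left_s14 : minkI (a - b) c = minkI a c - minkI b c := by
  simp only [minkI, Prod.fst_sub, Prod.snd_sub, inner_sub_left]
  ring

lemma minkI_sub_right_s14 : minkI a (b - c) = minkI a b - minkI a c := by
  simp only [minkI_comm_s14 a, minkI_sub_left_s14]

end MinkowskiForm

/-- The orthogonal projection of `ℝⁿ` along a nonzero vector, with values in `ℝⁿ⁻¹`. -/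
lemma exists_linearMap_norm_sq_eq_sub_inner_sq {n : ℕ} (v : EuclideanSpace ℝ (Fin n))
    (hv : v ≠ 0) :
    ∃ T : EuclideanSpace ℝ (Fin n) →ₗ[ℝ] EuclideanSpace ℝ (Fin (n - 1)),
      ∀ p, ‖T p‖ ^ 2 = ‖p‖ ^ 2 - ⟪v, p⟫ ^ 2 / ‖v‖ ^ 2 := by
  obtain _ | k := n
  · exact absurd (Subsingleton.elim v 0) hv
  have : Fact (Module.finrank ℝ (EuclideanSpace ℝ (Fin (k + 1))) = k + 1) := ⟨by simp⟩
  have hd : Module.finrank ℝ (ℝ ∙ v)ᗮ = k := Submodule.finrank_orthogonal_span_singleton hv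
  let e := ((stdOrthonormalBasis ℝ (ℝ ∙ v)ᗮ).reindex (finCongr hd)).repr
  refine ⟨e.toLinearEquiv.toLinearMap ∘ₗ ((ℝ ∙ v)ᗮ).orthogonalProjectionOnto.toLinearMap,
    fun p => ?_⟩
  have h1 : ‖e (((ℝ ∙ v)ᗮ).orthogonalProjectionOnto p)‖
      = ‖((ℝ ∙ v)ᗮ).orthogonalProjectionOnto p‖ := e.norm_map _
  have h2 := Submodule.norm_sq_eq_add_norm_sq_projection p (ℝ ∙ v)
  have h3 : ‖(ℝ ∙ v).orthogonalProjectionOnto p‖ ^ 2 = ⟪v, p⟫ ^ 2 / ‖v‖ ^ 2 := by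
    have hv' : ‖v‖ ≠ 0 := norm_ne_zero_iff.2 hv
    rw [← Submodule.norm_coe, ← Submodule.starProjection_apply,
      Submodule.starProjection_singleton, norm_smul, mul_pow, Real.norm_eq_abs, sq_abs]
    simp only [RCLike.ofReal_real_eq_id, id]
    field_simp
  change ‖e (((ℝ ∙ v)ᗮ).orthogonalProjectionOnto p)‖ ^ 2 = _
  rw [h1, ← h3]
  linarith

/-- The quotient of the hyperplane `I`-orthogonal to a null vector `f` by `f` is Euclidean. -/
lemma exists_linearMap_norm_sq_eq_neg_minkI {n : ℕ} (f : EuclideanSpace ℝ (Fin n) × ℝ)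
    (hf : minkI f f = 0) (hf0 : f ≠ 0) :
    ∃ T : EuclideanSpace ℝ (Fin n) × ℝ →ₗ[ℝ] EuclideanSpace ℝ (Fin (n - 1)),
      ∀ p, minkI p f = 0 → ‖T p‖ ^ 2 = -minkI p p := by
  have hnorm : ‖f.1‖ ^ 2 = f.2 ^ 2 := by
    rw [minkI, real_inner_self_eq_norm_sq] at hf
    linarith
  have hv : f.1 ≠ 0 := by
    intro h1
    have h2 : f.2 = 0 := by simpa [h1, eq_comm] using hnorm
    exact hf0 (Prod.ext h1 h2)
  obtain ⟨T, hT⟩ := exists_linearMap_norm_sq_eq_sub_inner_sq f.1 hv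
  refine ⟨T ∘ₗ LinearMap.fst ℝ _ _, fun p hp => ?_⟩
  have hf2 : f.2 ≠ 0 := by
    rintro h2
    rw [h2] at hnorm
    exact hv (by simpa using hnorm)
  have hin : ⟪f.1, p.1⟫ = p.2 * f.2 := by
    rw [minkI, real_inner_comm] at hp
    linarith
  rw [LinearMap.comp_apply, LinearMap.fst_apply, hT, hin, hnorm, minkI,
    real_inner_self_eq_norm_sq]
  field_simp
  ring

/-- Unit spacelike vectors give spheres in the upper half-space model with `f` at infinity:
the distance of two centers in terms of the radii and the angle. -/
lemma norm_sq_sub_of_minkI {n : ℕ} {k : ℕ} {f : EuclideanSpace ℝ (Fin n) × ℝ}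
    {T : EuclideanSpace ℝ (Fin n) × ℝ →ₗ[ℝ] EuclideanSpace ℝ (Fin k)}
    (hT : ∀ p, minkI p f = 0 → ‖T p‖ ^ 2 = -minkI p p)
    {v v' : EuclideanSpace ℝ (Fin n) × ℝ} (hv : minkI v v = -1) (hv' : minkI v' v' = -1)
    (hvf : minkI v f ≠ 0) (hvf' : minkI v' f ≠ 0) :
    ‖T ((minkI v f)⁻¹ • v) - T ((minkI v' f)⁻¹ • v')‖ ^ 2 =
      (minkI v f)⁻¹ ^ 2 + (minkI v' f)⁻¹ ^ 2
        + 2 * minkI v v' * (minkI v f)⁻¹ * (minkI v' f)⁻¹ := by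
  rw [← map_sub, hT]
  · simp only [minkI_sub_left_s14, minkI_sub_right_s14, minkI_smul_left_s14, minkI_smul_right_s14, hv, hv',
      minkI_comm_s14 v' v]
    ring
  · simp only [minkI_sub_left_s14, minkI_smul_left_s14, inv_mul_cancel₀ hvf, inv_mul_cancel₀ hvf',
      sub_self]

theorem stmt14 {n m : ℕ} (hn : 2 ≤ n)
    (h : EuclideanSpace ℝ (Fin n) × ℝ)
    (w : Fin (m + 1) → EuclideanSpace ℝ (Fin n) × ℝ)
    (hh : 0 < minkI h h) (hneg : ∀ i, minkI (w i) (w i) < 0)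
    (hpos : ∀ i, 0 < minkI h (w i))
    (hcode : ∀ i j, i ≠ j → 0 ≤ minkI (w i) (w j) ∧
      ∀ a b : ℝ, 0 ≤ a → 0 ≤ b →
        minkI (a • w i + b • w j) (a • w i + b • w j) ≤ 0) :
    ∃ (z : Fin m → EuclideanSpace ℝ (Fin (n - 1))) (d₀ : ℝ) (d : Fin m → ℝ),
      0 < d₀ ∧ (∀ i, 0 < d i) ∧
      (∀ j, max 0 (d j ^ 2 - d₀ ^ 2) < ‖z j‖ ^ 2) ∧
      (∀ i, |d₀ - d i| ≤ ‖z i‖ ∧ ‖z i‖ ≤ Real.sqrt (d₀ ^ 2 + d i ^ 2)) ∧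
      (∀ i j, i ≠ j →
        Real.sqrt (d i ^ 2 + d j ^ 2) ≤ ‖z i - z j‖ ∧ ‖z i - z j‖ ≤ d i + d j) := by
  set r : Fin (m + 1) → ℝ := fun i => (√(-minkI (w i) (w i)))⁻¹ with hr
  have hr0 : ∀ i, 0 < r i := fun i => inv_pos.2 (Real.sqrt_pos.2 (by linarith [hneg i]))
  set v : Fin (m + 1) → EuclideanSpace ℝ (Fin n) × ℝ := fun i => r i • w i with hv
  have hvv : ∀ i, minkI (v i) (v i) = -1 := by
    intro i
    have h1 : 0 < -minkI (w i) (w i) := by linarith [hneg i]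
    have h2 := Real.sq_sqrt h1.le
    have h3 := (Real.sqrt_pos.2 h1).ne'
    simp only [hv, hr, minkI_smul_left_s14, minkI_smul_right_s14]
    field_simp
    linarith
  have hhv : ∀ i, 0 < minkI h (v i) := fun i => by
    simp only [hv, minkI_smul_right_s14]
    exact mul_pos (hr0 i) (hpos i)
  have hc0 : ∀ i j, i ≠ j → 0 ≤ minkI (v i) (v j) := fun i j hij => by
    simp only [hv, minkI_smul_left_s14, minkI_smul_right_s14]
    exact mul_nonneg (hr0 j).le (mul_nonneg (hr0 i).le (hcode i j hij).1) |>.trans_eq (by ring)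
  have hc1 : ∀ i j, i ≠ j → minkI (v i) (v j) ≤ 1 := fun i j hij => by
    have h1 : minkI (v i + v j) (v i + v j) ≤ 0 :=
      (hcode i j hij).2 (r i) (r j) (hr0 i).le (hr0 j).le
    simp only [minkI_add_left_s14, minkI_add_right_s14, hvv, minkI_comm_s14 (v j) (v i)] at h1
    linarith
  -- `x` is the projection of `h` to the wall of `v 0`, and `f` lies beyond that wall.
  set x := h + minkI h (v 0) • v 0 with hx
  have hx0 : minkI x (v 0) = 0 := by
    simp only [hx, minkI_add_left_s14, minkI_smul_left_s14, hvv]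
    ring
  have hxx : 0 < minkI x x := by
    have h1 : minkI x x = minkI h h + minkI h (v 0) ^ 2 := by
      simp only [hx, minkI_add_left_s14, minkI_smul_left_s14, minkI_add_right_s14, minkI_smul_right_s14, hvv,
        minkI_comm_s14 (v 0) h]
      ring
    rw [h1]
    positivity
  have hxj : ∀ j : Fin m, 0 < minkI x (v j.succ) := fun j => by
    simp only [hx, minkI_add_left_s14, minkI_smul_left_s14 (v 0)]
    exact add_pos_of_pos_of_nonneg (hhv _)
      (mul_nonneg (hhv 0).le (hc0 _ _ (Fin.succ_ne_zero j).symm))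
  set s := √(minkI x x) with hs
  have hs0 : 0 < s := Real.sqrt_pos.2 hxx
  have hs2 : s ^ 2 = minkI x x := Real.sq_sqrt hxx.le
  set f := x + s • v 0 with hf
  have hff : minkI f f = 0 := by
    simp only [hf, minkI_add_left_s14, minkI_smul_left_s14, minkI_add_right_s14, minkI_smul_right_s14, hvv,
      minkI_comm_s14 (v 0) x, hx0, ← hs2]
    ring
  have hf0 : minkI (v 0) f = -s := by
    simp only [hf, minkI_add_right_s14, minkI_smul_right_s14, hvv, minkI_comm_s14 (v 0) x, hx0]
    ring
  have hfj : ∀ j : Fin m, s * minkI (v 0) (v j.succ) < minkI (v j.succ) f := fun j => by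
    rw [hf, minkI_comm_s14 _ (x + _), minkI_add_left_s14, minkI_smul_left_s14 (v 0)]
    linarith [hxj j]
  have hfj0 : ∀ j : Fin m, 0 < minkI (v j.succ) f := fun j =>
    (mul_nonneg hs0.le (hc0 _ _ (Fin.succ_ne_zero j).symm)).trans_lt (hfj j)
  have hfne : f ≠ 0 := by
    intro h0
    rw [h0] at hf0
    simp only [minkI, Prod.fst_zero, Prod.snd_zero, inner_zero_right] at hf0
    linarith
  obtain ⟨T, hT⟩ := exists_linearMap_norm_sq_eq_neg_minkI f hff hfne
  have hd : ∀ j : Fin m, 0 < (minkI (v j.succ) f)⁻¹ := fun j => inv_pos.2 (hfj0 j)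
  have hs' : 0 < s⁻¹ := inv_pos.2 hs0
  let z : Fin m → EuclideanSpace ℝ (Fin (n - 1)) := fun j =>
    T ((minkI (v j.succ) f)⁻¹ • v j.succ) - T ((minkI (v 0) f)⁻¹ • v 0)
  have hz : ∀ j, ‖z j‖ ^ 2 = s⁻¹ ^ 2 + (minkI (v j.succ) f)⁻¹ ^ 2
      - 2 * minkI (v 0) (v j.succ) * s⁻¹ * (minkI (v j.succ) f)⁻¹ := fun j => by
    have h1 := norm_sq_sub_of_minkI hT (hvv j.succ) (hvv 0) (hfj0 j).ne'
      (by rw [hf0]; exact (neg_neg_of_pos hs0).ne)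
    rw [h1, hf0, minkI_comm_s14 (v j.succ) (v 0), inv_neg]
    ring
  have hzz : ∀ i j, ‖z i - z j‖ ^ 2 =
      (minkI (v i.succ) f)⁻¹ ^ 2 + (minkI (v j.succ) f)⁻¹ ^ 2
      + 2 * minkI (v i.succ) (v j.succ) * (minkI (v i.succ) f)⁻¹ * (minkI (v j.succ) f)⁻¹ :=
    fun i j => by
      rw [sub_sub_sub_cancel_right]
      exact norm_sq_sub_of_minkI hT (hvv _) (hvv _) (hfj0 i).ne' (hfj0 j).ne'
  have habs : ∀ j, |s⁻¹ - (minkI (v j.succ) f)⁻¹| ≤ ‖z j‖ := fun j => by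
    refine abs_le_of_sq_le_sq ?_ (norm_nonneg _)
    rw [hz]
    nlinarith [mul_nonneg (sub_nonneg.2 (hc1 0 j.succ (Fin.succ_ne_zero j).symm))
      (mul_pos hs' (hd j)).le]
  have hlt : ∀ j, (minkI (v j.succ) f)⁻¹ ^ 2 - s⁻¹ ^ 2 < ‖z j‖ ^ 2 := fun j => by
    have h1 : minkI (v 0) (v j.succ) * (minkI (v j.succ) f)⁻¹ < s⁻¹ := by
      rw [← div_eq_mul_inv, div_lt_iff₀ (hfj0 j), inv_mul_eq_div, lt_div_iff₀ hs0]
      linarith [hfj j]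
    rw [hz]
    nlinarith [mul_pos hs' (sub_pos.2 h1)]
  refine ⟨z, s⁻¹, fun j => (minkI (v j.succ) f)⁻¹, hs', hd, fun j => ?_,
    fun j => ⟨habs j, ?_⟩, fun i j hij => ⟨?_, ?_⟩⟩
  · refine max_lt (lt_of_le_of_ne (sq_nonneg _) fun h0 => ?_) (hlt j)
    have h1 := habs j
    have h2 := hlt j
    rw [pow_eq_zero_iff two_ne_zero |>.1 h0.symm] at h1 h2
    rw [← sub_eq_zero.1 (abs_nonpos_iff.1 h1)] at h2
    simp at h2
  · refine Real.le_sqrt_of_sq_le ?_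
    rw [hz]
    have := mul_nonneg (hc0 0 j.succ (Fin.succ_ne_zero j).symm) (mul_pos hs' (hd j)).le
    linarith
  · refine Real.sqrt_le_iff.2 ⟨norm_nonneg _, ?_⟩
    rw [hzz]
    have := mul_nonneg (hc0 i.succ j.succ ((Fin.succ_injective m).ne hij))
      (mul_pos (hd i) (hd j)).le
    linarith
  · refine le_of_sq_le_sq ?_ (add_pos (hd i) (hd j)).le
    rw [hzz]
    nlinarith [mul_nonneg (sub_nonneg.2 (hc1 i.succ j.succ ((Fin.succ_injective m).ne hij)))
      (mul_pos (hd i) (hd j)).le]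
end

section
/- For all real numbers d₁, d₂ with 0 < d₁ ≤ d₂ ≤ 1, one has (d₁ + d₂ + 1)·d₁ / ((d₁ + d₂)·(d₁ + 1)) ≤ 3/4. -/
theorem stmt16 (d₁ d₂ : ℝ) (h₁ : 0 < d₁) (h₁₂ : d₁ ≤ d₂) (h₂ : d₂ ≤ 1) :
    (d₁ + d₂ + 1) * d₁ / ((d₁ + d₂) * (d₁ + 1)) ≤ 3 / 4 := by
  have hd₂ : 0 < d₂ := h₁.trans_le h₁₂
  have hd₁ : d₁ ≤ 1 := h₁₂.trans h₂
  rw [div_le_div_iff₀ (by positivity) (by norm_num)]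
  nlinarith [mul_le_of_le_one_right h₁.le hd₁, mul_le_of_le_one_left hd₂.le hd₁]
end

section
/- Let E be a real Euclidean (finite-dimensional inner product) space, let z₁, z₂, z₃ ∈ E, and let 0 < d₁ ≤ d₂ ≤ d₃ be real numbers with √(d_i² + d_j²) ≤ ‖z_i − z_j‖ ≤ d_i + d_j for all i ≠ j. If the angle θ₃ = ∠(z₁, z₃, z₂) at the vertex z₃ satisfies θ₃ ≥ π/2, then d₁ = d₂ = d₃, the triangle is right-angled with ‖z₁ − z₂‖ = 2·d₃ and ‖z₁ − z₃‖ = ‖z₂ − z₃‖ = √2·d₃, and the angle at z₁ satisfies ∠(z₂, z₁, z₃) = π/4. -/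
theorem stmt17 {E : Type*} [NormedAddCommGroup E] [InnerProductSpace ℝ E]
    [FiniteDimensional ℝ E] (z₁ z₂ z₃ : E) (d₁ d₂ d₃ : ℝ)
    (hd₁ : 0 < d₁) (hd₁₂ : d₁ ≤ d₂) (hd₂₃ : d₂ ≤ d₃)
    (h₁₂ : Real.sqrt (d₁ ^ 2 + d₂ ^ 2) ≤ ‖z₁ - z₂‖ ∧ ‖z₁ - z₂‖ ≤ d₁ + d₂)
    (h₁₃ : Real.sqrt (d₁ ^ 2 + d₃ ^ 2) ≤ ‖z₁ - z₃‖ ∧ ‖z₁ - z₃‖ ≤ d₁ + d₃)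
    (h₂₃ : Real.sqrt (d₂ ^ 2 + d₃ ^ 2) ≤ ‖z₂ - z₃‖ ∧ ‖z₂ - z₃‖ ≤ d₂ + d₃)
    (hθ₃ : Real.pi / 2 ≤ EuclideanGeometry.angle z₁ z₃ z₂) :
    d₁ = d₃ ∧ d₂ = d₃ ∧ ‖z₁ - z₂‖ = 2 * d₃ ∧
      ‖z₁ - z₃‖ = Real.sqrt 2 * d₃ ∧ ‖z₂ - z₃‖ = Real.sqrt 2 * d₃ ∧
      EuclideanGeometry.angle z₂ z₁ z₃ = Real.pi / 4 := by
  have hcos : Real.cos (EuclideanGeometry.angle z₁ z₃ z₂) ≤ 0 :=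
    Real.cos_nonpos_of_pi_div_two_le_of_le hθ₃
      (by linarith [EuclideanGeometry.angle_le_pi z₁ z₃ z₂, Real.pi_pos])
  have hlaw₃ := EuclideanGeometry.law_cos z₁ z₃ z₂
  have hlaw₁ := EuclideanGeometry.law_cos z₂ z₁ z₃
  rw [dist_comm z₂ z₁, dist_comm z₃ z₁] at hlaw₁
  simp only [dist_eq_norm] at hlaw₃ hlaw₁
  have hc := h₁₂.2
  have hb := (Real.sqrt_le_left (norm_nonneg _)).1 h₁₃.1
  have ha := (Real.sqrt_le_left (norm_nonneg _)).1 h₂₃.1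
  have hc₀ := norm_nonneg (z₁ - z₂)
  have hb₀ := norm_nonneg (z₁ - z₃)
  have ha₀ := norm_nonneg (z₂ - z₃)
  generalize ‖z₁ - z₂‖ = c at *
  generalize ‖z₁ - z₃‖ = b at *
  generalize ‖z₂ - z₃‖ = a at *
  have hprod : b * a * Real.cos (EuclideanGeometry.angle z₁ z₃ z₂) ≤ 0 :=
    mul_nonpos_of_nonneg_of_nonpos (mul_nonneg hb₀ ha₀) hcos
  have hc₂ : c * c ≤ (d₁ + d₂) * (d₁ + d₂) := mul_self_le_mul_self hc₀ hc
  have hd : d₃ * d₃ ≤ d₁ * d₂ := by nlinarith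
  have e₁ : d₁ = d₃ := by nlinarith
  have e₂ : d₂ = d₃ := by linarith
  subst e₁
  subst e₂
  have hs₀ := Real.sqrt_nonneg 2
  have hs : Real.sqrt 2 ^ 2 = 2 := Real.sq_sqrt (by norm_num)
  have eb : b = Real.sqrt 2 * d₂ := by
    rw [← sq_eq_sq₀ hb₀ (by positivity), mul_pow, hs]
    nlinarith
  have ea : a = Real.sqrt 2 * d₂ := by
    rw [← sq_eq_sq₀ ha₀ (by positivity), mul_pow, hs]
    nlinarith
  have ec : c = 2 * d₂ := by
    rw [← sq_eq_sq₀ hc₀ (by positivity)]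
    nlinarith
  refine ⟨rfl, rfl, ec, eb, ea, ?_⟩
  apply Real.injOn_cos
    ⟨EuclideanGeometry.angle_nonneg _ _ _, EuclideanGeometry.angle_le_pi _ _ _⟩
    ⟨by positivity, by linarith [Real.pi_pos]⟩
  rw [Real.cos_pi_div_four]
  subst ea eb ec
  have hne : 4 * Real.sqrt 2 * d₂ ^ 2 ≠ 0 := by positivity
  apply mul_left_cancel₀ hne
  linear_combination hlaw₁ - 2 * d₂ ^ 2 * hs
end
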